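/- Let (R,m) be a Noetherian local ring and M a finitely generated R-module with dim_R M = dim R. Then the following are equivalent: (1) M is an unmixed R-module; (2) there exist a Gorenstein local ring S with dim S = dim R, a surjective ring homomorphism S → R̂, and an embedding of the m-adic completion M̂ into S^n as an S-module for some n > 0. -/

import Mathlib

open IsLocalRing

section Defs

variable (R : Type) [CommRing R]

/-- The length of a module, as the Krull dimension of its lattice of submodules. -/
noncomputable def mLength (M : Type) [AddCommGroup M] [Module R M] : WithBot ℕ∞ :=
  Order.krullDim (Submodule R M)

/-- The (Krull) dimension of a module. -/
noncomputable def mDim (M : Type) [AddCommGroup M] [Module R M] : WithBot ℕ∞ :=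
  ringKrullDim (R ⧸ Submodule.annihilator (⊤ : Submodule R M))

/-- `f` is eventually given by the Hilbert-type polynomial of degree `t` with
coefficients `s 0, …, s t` (written in the binomial basis with alternating signs). -/
def IsHilbPolyAt (f : ℕ → WithBot ℕ∞) (t : ℕ) (s : ℕ → ℤ) : Prop :=
  ∃ N : ℕ, ∀ n ≥ N, ∃ l : ℕ, f n = (l : ℕ∞) ∧
    (l : ℤ) = ∑ i ∈ Finset.range (t + 1), (-1 : ℤ) ^ i * s i * ((n + t - i).choose (t - i) : ℤ)

/-- `s 0, …, s t` are the Hilbert coefficients `e_i(I, M)`, i.e.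
`λ(M/I^{n+1}M) = ∑ (-1)^i e_i(I,M) C(n+t-i, t-i)` for `n ≫ 0`. -/
def HasHilbCoeffs (I : Ideal R) (M : Type) [AddCommGroup M] [Module R M]
    (t : ℕ) (s : ℕ → ℤ) : Prop :=
  IsHilbPolyAt (fun n => mLength R (M ⧸ (I ^ (n + 1) • (⊤ : Submodule R M)))) t s

/-- The unmixed component `U_M(0)` of `M`: the largest submodule of dimension `< dim M`. -/
noncomputable def unmixedComp (M : Type) [AddCommGroup M] [Module R M] : Submodule R M :=
  sSup {N : Submodule R M | mDim R ↥N < mDim R M}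

/-- `x` is a d-sequence on `M`. -/
def IsDSeq {r : ℕ} (x : Fin r → R) (M : Type) [AddCommGroup M] [Module R M] : Prop :=
  ∀ i j : Fin r, i ≤ j →
    Submodule.comap (LinearMap.lsmul R M (x i * x j))
        (Ideal.span (x '' {k | k < i}) • (⊤ : Submodule R M))
      = Submodule.comap (LinearMap.lsmul R M (x j))
        (Ideal.span (x '' {k | k < i}) • (⊤ : Submodule R M))

/-- `x` is a standard (d⁺-) system: all power sequences in any order are d-sequences. -/
def IsStandardSeq {r : ℕ} (x : Fin r → R) (M : Type) [AddCommGroup M] [Module R M] : Prop :=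
  ∀ n : Fin r → ℕ, (∀ k, 1 ≤ n k) → ∀ σ : Equiv.Perm (Fin r),
    IsDSeq R (fun k => x (σ k) ^ n (σ k)) M

/-- The integral closure of an ideal, as a set. -/
def intClos (Q : Ideal R) : Set R :=
  {x : R | ∃ n : ℕ, 0 < n ∧ ∃ a : ℕ → R, (∀ i, 1 ≤ i → i ≤ n → a i ∈ Q ^ i) ∧
    x ^ n + ∑ i ∈ Finset.Icc 1 n, a i * x ^ (n - i) = 0}

variable [IsLocalRing R]

/-- `h ∈ I` is superficial for `M` with respect to `I`. -/
def IsSuperficial (I : Ideal R) (M : Type) [AddCommGroup M] [Module R M] (h : R) : Prop :=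
  h ∈ I ∧ ∃ c N : ℕ, ∀ n ≥ N,
    Submodule.comap (LinearMap.lsmul R M h) (I ^ (n + 1) • (⊤ : Submodule R M))
        ⊓ (I ^ c • (⊤ : Submodule R M))
      = I ^ n • (⊤ : Submodule R M)

/-- `Q` is a parameter ideal for `M` (`r` the dimension of `M`):
generated by `r` elements of the maximal ideal with `M/QM` of finite length. -/
def IsParamIdeal (Q : Ideal R) (M : Type) [AddCommGroup M] [Module R M] (r : ℕ) : Prop :=
  Q ≤ maximalIdeal R ∧ (∃ x : Fin r → R, Q = Ideal.span (Set.range x)) ∧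
    IsFiniteLength R (M ⧸ Q • (⊤ : Submodule R M))

/-- Local cohomology `H^i_𝔪(M)` with support in the maximal ideal. -/
noncomputable def LC (i : ℕ) (M : Type) [AddCommGroup M] [Module R M] : ModuleCat R :=
  (localCohomology (maximalIdeal R) i).obj (ModuleCat.of R M)

/-- `M` is Cohen–Macaulay: there is a regular sequence on `M` in the maximal ideal
whose length equals `dim M`. -/
def IsCM (M : Type) [AddCommGroup M] [Module R M] : Prop :=
  ∃ rs : List R, (∀ x ∈ rs, x ∈ maximalIdeal R) ∧ RingTheory.Sequence.IsRegular M rs ∧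
    (rs.length : WithBot ℕ∞) = mDim R M

/-- `M` is unmixed: `dim R̂/p = dim M` for every associated prime `p` of the completion `M̂`. -/
def IsUnmixed (M : Type) [AddCommGroup M] [Module R M] : Prop :=
  ∀ p ∈ associatedPrimes (AdicCompletion (maximalIdeal R) R)
      (AdicCompletion (maximalIdeal R) M),
    ringKrullDim ((AdicCompletion (maximalIdeal R) R) ⧸ p) = mDim R M

/-- `M` is generalized Cohen–Macaulay: `H^i_𝔪(M)` has finite length for `i < r = dim M`. -/
def IsGenCM (M : Type) [AddCommGroup M] [Module R M] (r : ℕ) : Prop :=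
  ∀ i < r, IsFiniteLength R ↥(LC R i M)

/-- The set `Λ(M)` of first Hilbert coefficients of parameter ideals for `M`. -/
def Lambda (M : Type) [AddCommGroup M] [Module R M] (r : ℕ) : Set ℤ :=
  {a : ℤ | ∃ (Q : Ideal R) (e : ℕ → ℤ),
    IsParamIdeal R Q M r ∧ HasHilbCoeffs R Q M r e ∧ e 1 = a}

/-- A standard parameter ideal: one generated by a standard system of parameters. -/
def IsStandardParamIdeal (Q : Ideal R) (M : Type) [AddCommGroup M] [Module R M]
    (r : ℕ) : Prop :=
  IsParamIdeal R Q M r ∧ ∃ x : Fin r → R, Q = Ideal.span (Set.range x) ∧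
    IsStandardSeq R x M

/-- `M` is Buchsbaum: every parameter ideal for `M` is standard. -/
def IsBuchsbaum (M : Type) [AddCommGroup M] [Module R M] (r : ℕ) : Prop :=
  ∀ Q : Ideal R, IsParamIdeal R Q M r → IsStandardParamIdeal R Q M r

/-- `M` is a Vasconcelos module. -/
def IsVasconcelos (M : Type) [AddCommGroup M] [Module R M] : Prop :=
  mDim R M ≤ 0 ∨ (0 < mDim R M ∧ ∃ (r : ℕ) (Q : Ideal R) (e : ℕ → ℤ),
    mDim R M = (r : ℕ∞) ∧ IsParamIdeal R Q M r ∧ HasHilbCoeffs R Q M r e ∧ e 1 = 0)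

/-- A Gorenstein local ring: Noetherian, Cohen–Macaulay, with an irreducible parameter ideal. -/
def IsGorensteinLocalRing : Prop :=
  IsNoetherianRing R ∧ IsCM R R ∧ ∃ (r : ℕ) (Q : Ideal R),
    mDim R R = (r : ℕ∞) ∧ IsParamIdeal R Q R r ∧
    ∀ I J : Ideal R, Q = I ⊓ J → Q = I ∨ Q = J

/-- `E` is an injective envelope of the residue field `R/𝔪`. -/
def IsInjEnvResidue (E : Type) [AddCommGroup E] [Module R E] : Prop :=
  Module.Injective R E ∧ ∃ ι : (R ⧸ maximalIdeal R) →ₗ[R] E, Function.Injective ι ∧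
    ∀ N : Submodule R E, N ⊓ LinearMap.range ι = ⊥ → N = ⊥

end Defs

/-- A (not necessarily local) Cohen–Macaulay ring: Noetherian,
with all localizations at primes Cohen–Macaulay. -/
def IsCMRing (S : Type) [CommRing S] : Prop :=
  IsNoetherianRing S ∧ ∀ (p : Ideal S) [p.IsPrime],
    IsCM (Localization.AtPrime p) (Localization.AtPrime p)

/-- A (not necessarily local) Gorenstein ring. -/
def IsGorensteinRing (S : Type) [CommRing S] : Prop :=
  IsNoetherianRing S ∧ ∀ (p : Ideal S) [p.IsPrime],
    IsGorensteinLocalRing (Localization.AtPrime p)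

/-- `HDegRel R I E M v` : `v` is the homological degree `hdeg_I(M)` computed
with Matlis duals taken relative to `E`. -/
inductive HDegRel (R : Type) [CommRing R] [IsLocalRing R] (I : Ideal R)
    (E : Type) [AddCommGroup E] [Module R E] : ModuleCat R → ℕ → Prop where
  | base : ∀ (M : ModuleCat R) (l : ℕ), mDim R M ≤ 0 → mLength R M = (l : ℕ∞) →
      HDegRel R I E M l
  | step : ∀ (M : ModuleCat R) (r : ℕ), mDim R M = (r : ℕ∞) → 0 < r →
      ∀ (e : ℕ → ℤ) (e0 : ℕ), HasHilbCoeffs R I M r e → e 0 = (e0 : ℤ) →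
      ∀ v : ℕ → ℕ,
        (∀ j < r, HDegRel R I E (ModuleCat.of R ((LC R j M) →ₗ[R] E)) (v j)) →
      HDegRel R I E M (e0 + ∑ j ∈ Finset.range r, (r - 1).choose j * v j)

namespace UnmixedEmbedding

section Dimension

open scoped Pointwise

theorem ringKrullDim_quotient_succ_le_of_lt {A : Type*} [CommRing A] {p q : Ideal A}
    (hp : p.IsPrime) (h : p < q) : ringKrullDim (A ⧸ q) + 1 ≤ ringKrullDim (A ⧸ p) := by
  obtain ⟨x, hxq, hxp⟩ := Set.exists_of_ssubset h
  refine ringKrullDim_succ_le_of_surjective (Ideal.Quotient.factor h.le)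
    (Ideal.Quotient.factor_surjective h.le) (r := Ideal.Quotient.mk p x) ?_ ?_
  · rw [mem_nonZeroDivisors_iff_ne_zero]
    simpa [Ideal.Quotient.eq_zero_iff_mem] using hxp
  · simpa [Ideal.Quotient.eq_zero_iff_mem] using hxq

theorem ringKrullDim_quotient_le_of_le {A : Type*} [CommRing A] {p q : Ideal A}
    (h : p ≤ q) : ringKrullDim (A ⧸ q) ≤ ringKrullDim (A ⧸ p) :=
  ringKrullDim_le_of_surjective (Ideal.Quotient.factor h) (Ideal.Quotient.factor_surjective h)

theorem ringKrullDim_quotient_le_of_forall_prime {A : Type*} [CommRing A] {K : Ideal A}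
    {n : WithBot ℕ∞} (h : ∀ q : Ideal A, q.IsPrime → K ≤ q → ringKrullDim (A ⧸ q) ≤ n) :
    ringKrullDim (A ⧸ K) ≤ n := by
  rw [ringKrullDim_quotient]
  refine iSup_le fun l => ?_
  refine le_trans ?_ (h l.head.1.asIdeal l.head.1.isPrime l.head.2)
  rw [ringKrullDim_quotient]
  refine le_iSup_of_le
    { length := l.length
      toFun := fun i => ⟨(l i).1, ?_⟩
      step := fun i => l.step i } le_rfl
  exact l.monotone (Fin.zero_le i)

/-- An associated prime of `N` propagates to one of `N / rN` strictly above it. -/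
theorem exists_isAssociatedPrime_quotSMulTop {S : Type*} [CommRing S] [IsLocalRing S]
    [IsNoetherianRing S] {N : Type*} [AddCommGroup N] [Module S N] [Module.Finite S N]
    {r : S} (hr : IsSMulRegular N r) (hrm : r ∈ maximalIdeal S) {p : Ideal S}
    (hp : IsAssociatedPrime p N) :
    ∃ q : Ideal S, IsAssociatedPrime q (QuotSMulTop r N) ∧ p < q := by
  obtain ⟨hpp, x, hx⟩ := isAssociatedPrime_iff.mp hp
  have hpx : ∀ a, a ∈ p ↔ a • x = 0 := fun a => by rw [hx, Submodule.mem_colon_singleton]; simp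
  have hx0 : x ≠ 0 := fun h => hpp.ne_top ((Ideal.eq_top_iff_one _).2 ((hpx 1).2 (by simp [h])))
  let N' : Submodule S N := Submodule.torsionBySet S N p
  have hmem : ∀ n, n ∈ N' ↔ ∀ a ∈ p, a • n = 0 := fun n => by
    simp [N', Submodule.mem_torsionBySet_iff]
  have hxN : x ∈ N' := (hmem x).2 fun a ha => (hpx a).1 ha
  obtain ⟨n, hnN, hn⟩ : ∃ n ∈ N', n ∉ r • (⊤ : Submodule S N) := by
    by_contra! hcon
    have hle : N' ≤ maximalIdeal S • N' := by
      intro n hn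
      obtain ⟨m, -, rfl⟩ := (Submodule.mem_smul_pointwise_iff_exists _ _ _).1 (hcon n hn)
      refine Submodule.smul_mem_smul hrm ((hmem m).2 fun a ha => hr ?_)
      change r • a • m = r • 0
      rw [smul_zero, smul_comm]
      exact (hmem _).1 hn a ha
    have := Submodule.eq_bot_of_le_smul_of_le_jacobson_bot _ N'
      (IsNoetherian.noetherian N') hle (maximalIdeal_le_jacobson _)
    rw [this] at hxN
    exact hx0 hxN
  let y : QuotSMulTop r N := Submodule.Quotient.mk n
  have hy : y ≠ 0 := fun h => hn ((Submodule.Quotient.mk_eq_zero _).1 h)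
  obtain ⟨q, hq, hle⟩ := exists_le_isAssociatedPrime_of_isNoetherianRing S y hy
  refine ⟨q, hq, lt_of_le_of_ne ?_ ?_⟩
  · refine fun a ha => hle ?_
    rw [Submodule.mem_colon_singleton]
    change a • Submodule.Quotient.mk n ∈ _
    rw [← Submodule.Quotient.mk_smul, (hmem n).1 hnN a ha]; simp
  · rintro rfl
    have : r ∈ p := hle (by
      rw [Submodule.mem_colon_singleton]
      change r • Submodule.Quotient.mk n ∈ _
      rw [← Submodule.Quotient.mk_smul, Submodule.mem_bot, Submodule.Quotient.mk_eq_zero]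
      exact Submodule.smul_mem_pointwise_smul _ _ _ trivial)
    refine hx0 (hr ?_)
    change r • x = r • 0
    rw [smul_zero, (hpx r).1 this]

theorem length_le_ringKrullDim_quotient {S : Type*} [CommRing S] [IsLocalRing S]
    [IsNoetherianRing S] (rs : List S) : ∀ {N : Type*} [AddCommGroup N] [Module S N]
    [Module.Finite S N] (_ : RingTheory.Sequence.IsWeaklyRegular N rs)
    (_ : ∀ r ∈ rs, r ∈ maximalIdeal S) {p : Ideal S} (_ : IsAssociatedPrime p N),
    (rs.length : WithBot ℕ∞) ≤ ringKrullDim (S ⧸ p) := by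
  induction rs with
  | nil =>
    intro N _ _ _ _ _ p hp
    have := hp.isPrime
    simpa using ringKrullDim_nonneg_of_nontrivial
  | cons r rs ih =>
    intro N _ _ _ hreg hm p hp
    rw [RingTheory.Sequence.isWeaklyRegular_cons_iff] at hreg
    obtain ⟨q, hq, hlt⟩ := exists_isAssociatedPrime_quotSMulTop hreg.1 (hm r (by simp)) hp
    have h1 := ih hreg.2 (fun s hs => hm s (by simp [hs])) hq
    have := ringKrullDim_quotient_succ_le_of_lt hp.isPrime hlt
    refine le_trans ?_ this
    rw [List.length_cons]
    push_cast
    gcongr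

end Dimension

section CohenMacaulay

theorem mDim_self (S : Type) [CommRing S] : mDim S S = ringKrullDim S := by
  have : Submodule.annihilator (⊤ : Submodule S S) = ⊥ := by
    rw [eq_bot_iff]
    intro a ha
    simpa using Submodule.mem_annihilator.1 ha 1 trivial
  rw [mDim, this]
  exact ringKrullDim_eq_of_ringEquiv (RingEquiv.quotientBot S)

theorem ringKrullDim_quotient_eq_of_isCM {S : Type} [CommRing S] [IsLocalRing S]
    [IsNoetherianRing S] (hS : IsCM S S) {p : Ideal S} (hp : IsAssociatedPrime p S) :
    ringKrullDim (S ⧸ p) = ringKrullDim S := by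
  obtain ⟨rs, hm, hreg, hlen⟩ := hS
  refine le_antisymm (ringKrullDim_quotient_le p) ?_
  rw [← mDim_self S, ← hlen]
  exact length_le_ringKrullDim_quotient rs hreg.toIsWeaklyRegular hm hp

/-- If `N` embeds semilinearly in a free module over a Cohen–Macaulay local ring `S` surjecting
onto `A`, then `dim A/p = dim S` for all associated primes `p` of `N`. -/
theorem ringKrullDim_quotient_eq_of_embedding {S A : Type} [CommRing S] [IsLocalRing S]
    [IsNoetherianRing S] (hS : IsCM S S) [CommRing A] {N : Type} [AddCommGroup N] [Module A N]
    (f : S →+* A) (hf : Function.Surjective f) {n : ℕ} (g : N → (Fin n → S))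
    (hg : Function.Injective g) (hadd : ∀ x y, g (x + y) = g x + g y)
    (hsmul : ∀ (s : S) (x : N), g (f s • x) = s • g x) {p : Ideal A}
    (hp : IsAssociatedPrime p N) : ringKrullDim (A ⧸ p) = ringKrullDim S := by
  have : IsNoetherianRing A := isNoetherianRing_of_surjective S A f hf
  obtain ⟨hpp, x, hx⟩ := isAssociatedPrime_iff.mp hp
  have h0 : g 0 = 0 := by simpa using hadd 0 0
  let q := p.comap f
  have hq : ∀ s, s ∈ q ↔ s • g x = 0 := fun s => by
    rw [← hsmul, ← h0, hg.eq_iff, Ideal.mem_comap, hx, Submodule.mem_colon_singleton]; simp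
  have hqp : q.IsPrime := Ideal.comap_isPrime f p
  have hass : IsAssociatedPrime q S := by
    have hinf : q = Finset.univ.inf fun i => (⊥ : Submodule S S).colon {g x i} := by
      ext s
      rw [hq, Submodule.mem_finsetInf]
      simp [funext_iff, Submodule.mem_colon_singleton]
    obtain ⟨i, -, hi⟩ := (Ideal.IsPrime.inf_le' hqp).1 hinf.ge
    refine isAssociatedPrime_iff.mpr ⟨hqp, g x i, le_antisymm ?_ hi⟩
    rw [hinf]
    exact Finset.inf_le (Finset.mem_univ i)
  rw [← ringKrullDim_quotient_eq_of_isCM hS hass]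
  exact (ringKrullDim_eq_of_ringEquiv (RingEquiv.ofBijective (Ideal.quotientMap p f le_rfl)
    ⟨Ideal.quotientMap_injective, Ideal.quotientMap_surjective hf⟩)).symm

end CohenMacaulay

section Completion

theorem exists_list_maximalIdeal_pow_le {A : Type*} [CommRing A] [IsLocalRing A]
    [IsNoetherianRing A] {e : ℕ} (h : ringKrullDim A ≤ e) :
    ∃ rs : List A, rs.length = e ∧ (∀ x ∈ rs, x ∈ maximalIdeal A) ∧
      ∃ N, maximalIdeal A ^ N ≤ Ideal.ofList rs := by
  obtain ⟨s, hs, hcard⟩ := (maximalIdeal A).exists_finset_card_eq_height_of_isNoetherianRing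
  have hle : s.card ≤ e := by
    rw [← maximalIdeal_height_eq_ringKrullDim, ← hcard] at h
    exact_mod_cast h
  have hofList : Ideal.ofList (s.toList ++ List.replicate (e - s.card) 0) = Ideal.span s := by
    rw [Ideal.ofList_append]
    have : Ideal.ofList (List.replicate (e - s.card) (0 : A)) = ⊥ := by
      rw [Ideal.ofList, Ideal.span_eq_bot]
      intro x hx
      exact List.eq_of_mem_replicate hx
    rw [this, sup_bot_eq, Ideal.ofList]
    congr 1
    ext x
    simp
  refine ⟨s.toList ++ List.replicate (e - s.card) 0, by simp; omega, ?_, ?_⟩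
  · intro x hx
    refine hs.1.2 ?_
    rw [← hofList]
    exact Ideal.subset_span hx
  · rw [hofList]
    refine Ideal.exists_pow_le_of_le_radical_of_fg ?_ (IsNoetherian.noetherian _)
    rw [Ideal.radical_eq_sInf]
    refine le_sInf fun q hq => ?_
    exact hs.2 ⟨hq.2, hq.1⟩ (le_maximalIdeal hq.2.ne_top)

theorem ringKrullDim_le_length {A : Type*} [CommRing A] [IsLocalRing A]
    [IsNoetherianRing A] {rs : List A} (hm : ∀ x ∈ rs, x ∈ maximalIdeal A) {N : ℕ}
    (hN : maximalIdeal A ^ N ≤ Ideal.ofList rs) : ringKrullDim A ≤ rs.length := by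
  classical
  have hspan : Ideal.ofList rs = Ideal.span (rs.toFinset : Set A) := by
    simp [Ideal.ofList]
  have hmin : maximalIdeal A ∈ (Ideal.span (rs.toFinset : Set A)).minimalPrimes := by
    rw [← hspan]
    refine ⟨⟨inferInstance, Ideal.span_le.2 hm⟩, fun q hq _ => ?_⟩
    have := hq.1
    exact Ideal.IsPrime.le_of_pow_le (hN.trans hq.2)
  have h := Ideal.height_le_card_of_mem_minimalPrimes_span_finset hmin
  rw [← maximalIdeal_height_eq_ringKrullDim]
  exact_mod_cast h.trans (by exact_mod_cast rs.toFinset_card_le)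

section Completion

theorem finite_adicCompletion (R : Type*) [CommRing R] [IsLocalRing R] (M : Type*)
    [AddCommGroup M] [Module R M] [Module.Finite R M] :
    Module.Finite (AdicCompletion (maximalIdeal R) R) (AdicCompletion (maximalIdeal R) M) :=
  Module.Finite.of_surjective _
    (AdicCompletion.ofTensorProduct_surjective_of_finite (maximalIdeal R) M)

variable (R : Type*) [CommRing R] [IsLocalRing R] [IsNoetherianRing R]

instance isNoetherianRing_adicCompletion_maximalIdeal :
    IsNoetherianRing (AdicCompletion (maximalIdeal R) R) := by
  obtain ⟨s, hs⟩ := IsNoetherian.noetherian (maximalIdeal R)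
  let P := MvPolynomial s R
  let I : Ideal P := MvPolynomial.idealOfVars s R
  let ev : P →+* R := MvPolynomial.eval₂Hom (RingHom.id R) Subtype.val
  have hI : I.map ev = maximalIdeal R := by
    simp only [I, MvPolynomial.idealOfVars]
    rw [← hs, Ideal.map_span, ← Set.range_comp]
    have : (⇑ev ∘ MvPolynomial.X : s → R) = Subtype.val := by
      ext i
      exact MvPolynomial.eval₂_X _ _ _
    rw [this, Subtype.range_coe_subtype]
    rfl
  have hpow : ∀ n, I ^ n ≤ (maximalIdeal R ^ n).comap ev := fun n => by
    rw [← Ideal.map_le_iff_le_comap, Ideal.map_pow, hI]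
  let f : AdicCompletion I P →+* AdicCompletion (maximalIdeal R) R :=
    AdicCompletion.liftRingHom (maximalIdeal R)
      (fun n => (Ideal.quotientMap _ ev (hpow n)).comp (AdicCompletion.evalₐ I n : _ →+* _))
      (by
        intro m n hle
        ext x
        induction x using AdicCompletion.induction_on with | _ a
        have h := a.2 hle
        rw [SModEq.sub_mem, smul_eq_mul, Ideal.mul_top] at h
        simp only [RingHom.comp_apply, RingHom.coe_coe, AdicCompletion.evalₐ_mk,
          Ideal.quotientMap_mk]
        refine (Ideal.Quotient.eq (I := maximalIdeal R ^ m)).2 ?_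
        rw [← map_sub, ← neg_sub, map_neg]
        exact neg_mem (hpow m h))
  have hf : f.comp (algebraMap P _) = (algebraMap R _).comp ev := by
    refine RingHom.ext fun x => AdicCompletion.ext_evalₐ fun n => ?_
    simp only [RingHom.comp_apply]
    rw [AdicCompletion.evalₐ_liftRingHom]
    rfl
  have hmap : (I.map (algebraMap P (AdicCompletion I P))).map f =
      maximalIdeal (AdicCompletion (maximalIdeal R) R) := by
    rw [Ideal.map_map, hf, ← Ideal.map_map, hI, AdicCompletion.maximalIdeal_eq_map]
  have hc := AdicCompletion.isAdicComplete_self I (MvPolynomial.idealOfVars_fg s R)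
  have hnoeth : IsNoetherianRing (AdicCompletion I P) :=
    isNoetherianRing_of_ringEquiv (MvPowerSeries s R)
      (MvPowerSeries.toAdicCompletionAlgEquiv s R).toRingEquiv
  have : IsHausdorff ((I.map (algebraMap P (AdicCompletion I P))).map f)
      (AdicCompletion (maximalIdeal R) R) := by
    rw [hmap]; infer_instance
  refine isNoetherianRing_of_surjective _ _ f
    (surjective_of_mk_map_comp_surjective (I := I.map (algebraMap P (AdicCompletion I P))) f ?_)
  intro y
  obtain ⟨y, rfl⟩ := Ideal.Quotient.mk_surjective y
  obtain ⟨r, hr⟩ := Ideal.Quotient.mk_surjective (AdicCompletion.evalOneₐ (maximalIdeal R) y)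
  refine ⟨algebraMap P _ (MvPolynomial.C r), ?_⟩
  rw [RingHom.comp_apply, ← RingHom.comp_apply f, hf, Ideal.Quotient.eq, hmap,
    AdicCompletion.maximalIdeal_eq_map,
    ← AdicCompletion.ker_evalOneₐ_eq_map _ (IsNoetherian.noetherian _), RingHom.mem_ker, map_sub,
    sub_eq_zero]
  refine Eq.trans ?_ hr
  exact congrArg _ (MvPolynomial.eval₂_C _ _ _)

theorem ringKrullDim_adicCompletion_le {d : ℕ} (h : ringKrullDim R ≤ d) :
    ringKrullDim (AdicCompletion (maximalIdeal R) R) ≤ d := by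
  obtain ⟨rs, hlen, hm, N, hN⟩ := exists_list_maximalIdeal_pow_le h
  have := ringKrullDim_le_length
    (rs := rs.map (algebraMap R (AdicCompletion (maximalIdeal R) R))) (N := N) ?_ ?_
  · simpa [hlen] using this
  · intro x hx
    obtain ⟨y, hy, rfl⟩ := List.mem_map.1 hx
    rw [AdicCompletion.maximalIdeal_eq_map]
    exact Ideal.mem_map_of_mem _ (hm y hy)
  · rw [AdicCompletion.maximalIdeal_eq_map, ← Ideal.map_pow, ← Ideal.map_ofList]
    exact Ideal.map_mono hN

end Completion

end Completion

section CoefficientPolynomial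

open Polynomial

/-- A square-zero extension of a field in characteristic `p` admits a coefficient field. -/
theorem exists_coefficient_subring {E k : Type*} [CommRing E] [Field k] (p : ℕ)
    [hp : Fact p.Prime] [CharP E p] (π : E →+* k) (hπ : Function.Surjective π)
    (hsq : ∀ x y, π x = 0 → π y = 0 → x * y = 0) :
    ∃ F : Subring E, (∀ x ∈ F, π x = 0 → x = 0) ∧ ∀ y, ∃ x ∈ F, π x = y := by
  have : Nontrivial E := π.domain_nontrivial
  have : CharP k p := by
    obtain ⟨q, hq⟩ := CharP.exists k
    have h1 : q ∣ p := (CharP.cast_eq_zero_iff k q p).1 (by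
      rw [← map_natCast π, CharP.cast_eq_zero, map_zero])
    rcases (Nat.dvd_prime hp.out).1 h1 with rfl | rfl
    · exact absurd (CharP.cast_eq_zero k 1) (by rw [Nat.cast_one]; exact one_ne_zero)
    · exact hq
  let 𝓕 : Set (Subring E) := {F | (frobenius E p).range ≤ F ∧ ∀ x ∈ F, π x = 0 → x = 0}
  obtain ⟨F, hF⟩ : ∃ F, Maximal (· ∈ 𝓕) F := by
    refine zorn_le_nonempty₀ 𝓕 ?_ (frobenius E p).range ⟨le_rfl, ?_⟩ |>.imp fun _ h => h.2
    · intro c hc hchain F0 hF0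
      refine ⟨sSup c, ⟨(hc hF0).1.trans (le_sSup hF0), fun x hx h0 => ?_⟩, fun _ => le_sSup⟩
      obtain ⟨G, hG, hxG⟩ := (Subring.mem_sSup_of_directedOn ⟨F0, hF0⟩ hchain.directedOn).1 hx
      exact (hc hG).2 x hxG h0
    · rintro _ ⟨c, rfl⟩ h
      rw [frobenius_def, map_pow] at h
      have h0 := eq_zero_of_pow_eq_zero h
      have h2 : c ^ 2 = 0 := by rw [pow_two]; exact hsq c c h0 h0
      rw [frobenius_def]
      exact pow_eq_zero_of_le hp.out.two_le h2
  obtain ⟨⟨hFrob, hinj⟩, hmax⟩ := hF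
  have hpow : ∀ c, c ^ p ∈ F := fun c => hFrob ⟨c, rfl⟩
  refine ⟨F, hinj, fun y => ?_⟩
  obtain ⟨a, rfl⟩ := hπ y
  by_contra hcon
  let K : Subfield k :=
    { (F.map π) with
      inv_mem' := by
        rintro _ ⟨x, hx, rfl⟩
        by_cases h0 : π x = 0
        · exact ⟨0, F.zero_mem, by simp [h0]⟩
        obtain ⟨z, hz⟩ := hπ (π x)⁻¹
        refine ⟨x ^ (p - 1) * z ^ p, F.mul_mem (F.pow_mem hx _) (hpow z), ?_⟩
        have hp1 : p = (p - 1) + 1 := (Nat.succ_pred_prime hp.out).symm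
        rw [map_mul, map_pow, map_pow, hz]
        nth_rewrite 2 [hp1]
        rw [pow_succ, ← mul_assoc, ← mul_pow, mul_inv_cancel₀ h0, one_pow, one_mul] }
  have hmemK : ∀ x, x ∈ K ↔ ∃ c ∈ F, π c = x := fun x => Iff.rfl
  let t : F →+* K := (π.comp F.subtype).codRestrict K fun x => ⟨x, x.2, rfl⟩
  have ht : Function.Bijective t := by
    constructor
    · rw [injective_iff_map_eq_zero]
      intro x hx
      exact Subtype.ext (hinj x x.2 (congrArg Subtype.val hx))
    · rintro ⟨_, x, hx, rfl⟩
      exact ⟨⟨x, hx⟩, rfl⟩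
  let e : F ≃+* K := RingEquiv.ofBijective t ht
  let s : K →+* E := F.subtype.comp e.symm.toRingHom
  have hs : ∀ x, π (s x) = x := fun x => congrArg Subtype.val (e.apply_symm_apply x)
  have hsF : ∀ x, s x ∈ F := fun x => (e.symm x).2
  have hsmem : ∀ c ∈ F, ∃ x, s x = c := fun c hc => ⟨e ⟨c, hc⟩, by simp [s]⟩
  let b : K := e ⟨a ^ p, hpow a⟩
  have hb : s b = a ^ p := by simp [s, b]
  have hirr : Irreducible (X ^ p - C b : K[X]) := by
    refine X_pow_sub_C_irreducible_of_prime hp.out fun c hc => hcon ⟨s c, hsF c, ?_⟩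
    have h1 : (π (s c)) ^ p = (π a) ^ p := by
      rw [← map_pow, ← map_pow, hc, hb, map_pow]
    exact frobenius_inj k p h1
  let ev : K[X] →+* E := eval₂RingHom s a
  have hev : ∀ g, π (ev g) = aeval (π a) g := by
    intro g
    simp only [ev, coe_eval₂RingHom, hom_eval₂, aeval_def]
    congr 1
    exact RingHom.ext hs
  have hmin : X ^ p - C b = minpoly K (π a) := by
    refine minpoly.eq_of_irreducible_of_monic hirr ?_ (monic_X_pow_sub_C b hp.out.ne_zero)
    rw [← hev]
    simp [ev, hb]
  have hF' : ev.range ∈ 𝓕 := by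
    refine ⟨fun c hc => ?_, ?_⟩
    · obtain ⟨x, hx⟩ := hsmem c (hFrob hc)
      exact ⟨C x, by simp [ev, hx]⟩
    · rintro _ ⟨g, rfl⟩ h
      rw [hev] at h
      obtain ⟨q, rfl⟩ : X ^ p - C b ∣ g := hmin ▸ minpoly.dvd K (π a) h
      simp [ev, hb]
  have hle : F ≤ ev.range := fun c hc => by
    obtain ⟨x, hx⟩ := hsmem c hc
    exact ⟨C x, by simp [ev, hx]⟩
  exact hcon ⟨a, hmax hF' hle ⟨X, by simp [ev]⟩, rfl⟩

end CoefficientPolynomial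

section CoefficientRing

section Tower

variable {T k : Type*} [CommRing T] [Field k] (p : ℕ) [hp : Fact p.Prime]
  (θ : T →+* k) (J : ℕ → Ideal T)

/-- Subrings `U` surjecting onto the residue field whose intersection with the kernel is
`pU` up to `J n`. -/
structure IsStage (n : ℕ) (U : Subring T) : Prop where
  surj : ∀ y, ∃ x ∈ U, θ x = y
  ker : ∀ x ∈ U, θ x = 0 → ∃ u ∈ U, x - p * u ∈ J n
  le : ∀ x ∈ J n, x ∈ U

variable {p θ J}

theorem IsStage.exists_next (hp0 : θ p = 0) (hpJ : (p : T) ∈ J 1)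
    (hmul : ∀ m n, J m * J n ≤ J (m + n)) (hanti : Antitone J) (hker : ∀ x ∈ J 1, θ x = 0)
    {n : ℕ} (hn : 1 ≤ n) {U : Subring T} (hU : IsStage p θ J n U) :
    ∃ U' ≤ U, IsStage p θ J (n + 1) U' ∧ ∀ u ∈ U, p * u ∈ U' := by
  have hpJ' : ∀ n, ∀ x ∈ J n, p * x ∈ J (n + 1) := fun n x hx => by
    rw [add_comm n 1]; exact hmul 1 n (Ideal.mul_mem_mul hpJ hx)
  have hpow : ∀ i, (p : T) ^ (i + 1) ∈ J (i + 1) := fun i => by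
    induction i with
    | zero => simpa using hpJ
    | succ i ih => rw [pow_succ']; exact hpJ' _ _ ih
  have hJ0 : ∀ x ∈ J (n + 1), θ x = 0 := fun x hx => hker x (hanti (by omega) hx)
  let 𝔞 : Ideal U := (J (n + 1)).comap U.subtype ⊔ Ideal.span {(p : U)}
  have hmem : ∀ x : U, x ∈ 𝔞 ↔ ∃ u ∈ U, (x : T) - p * u ∈ J (n + 1) := fun x => by
    rw [Submodule.mem_sup]
    constructor
    · rintro ⟨j, hj, z, hz, rfl⟩
      obtain ⟨u, rfl⟩ := Ideal.mem_span_singleton'.1 hz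
      refine ⟨u, u.2, ?_⟩
      have : ((j + u * (p : U) : U) : T) - p * u = j := by push_cast; ring
      rw [this]
      exact hj
    · rintro ⟨u, hu, hx⟩
      refine ⟨x - p * ⟨u, hu⟩, ?_, p * ⟨u, hu⟩, Ideal.mul_mem_right _ _
        (Ideal.mem_span_singleton_self _), by ring⟩
      simpa [Ideal.mem_comap] using hx
  let θU : U →+* k := θ.comp U.subtype
  have hθ𝔞 : ∀ x ∈ 𝔞, θU x = 0 := fun x hx => by
    obtain ⟨u, hu, h⟩ := (hmem x).1 hx
    have := hJ0 _ h
    rw [map_sub, map_mul, hp0, zero_mul, sub_zero] at this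
    exact this
  let π : U ⧸ 𝔞 →+* k := Ideal.Quotient.lift 𝔞 θU hθ𝔞
  have hπ : Function.Surjective π := fun y => by
    obtain ⟨x, hx, rfl⟩ := hU.surj y
    exact ⟨Ideal.Quotient.mk 𝔞 ⟨x, hx⟩, rfl⟩
  have : Nontrivial (U ⧸ 𝔞) := π.domain_nontrivial
  have hchar : CharP (U ⧸ 𝔞) p := by
    have h0 : ((p : ℕ) : U ⧸ 𝔞) = 0 := by
      rw [← map_natCast (Ideal.Quotient.mk 𝔞), Ideal.Quotient.eq_zero_iff_mem]
      exact Ideal.mem_sup_right (Ideal.mem_span_singleton_self _)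
    obtain ⟨q, hq⟩ := CharP.exists (U ⧸ 𝔞)
    rcases (Nat.dvd_prime hp.out).1 ((CharP.cast_eq_zero_iff (U ⧸ 𝔞) q p).1 h0) with rfl | rfl
    · exact absurd (CharP.cast_eq_zero (U ⧸ 𝔞) 1) (by rw [Nat.cast_one]; exact one_ne_zero)
    · exact hq
  have hsq : ∀ x y, π x = 0 → π y = 0 → x * y = 0 := by
    intro x y hx hy
    obtain ⟨x, rfl⟩ := Ideal.Quotient.mk_surjective x
    obtain ⟨y, rfl⟩ := Ideal.Quotient.mk_surjective y
    obtain ⟨u, hu, hxu⟩ := hU.ker x x.2 hx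
    obtain ⟨v, hv, hyv⟩ := hU.ker y y.2 hy
    rw [← map_mul, Ideal.Quotient.eq_zero_iff_mem, hmem]
    have hxu' : (x : T) - p * u ∈ U := hU.le _ hxu
    have hyv' : (y : T) - p * v ∈ U := hU.le _ hyv
    refine ⟨u * y + (x - p * u) * v, add_mem (mul_mem hu y.2) (mul_mem hxu' hv), ?_⟩
    have h : ((x * y : U) : T) - p * (u * y + (x - p * u) * v) =
        (x - p * u) * (y - p * v) := by push_cast; ring
    rw [h]
    exact hanti (by omega) (hmul n n (Ideal.mul_mem_mul hxu hyv))
  obtain ⟨F, hF0, hFs⟩ := exists_coefficient_subring p π hπ hsq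
  let U' : Subring T := (F.comap (Ideal.Quotient.mk 𝔞)).map U.subtype
  have hmemU' : ∀ x, x ∈ U' ↔ ∃ h : x ∈ U, Ideal.Quotient.mk 𝔞 ⟨x, h⟩ ∈ F := by
    intro x
    constructor
    · rintro ⟨y, hy, rfl⟩
      exact ⟨y.2, hy⟩
    · rintro ⟨h, hx⟩
      exact ⟨⟨x, h⟩, hx, rfl⟩
  have hle : U' ≤ U := fun x hx => ((hmemU' x).1 hx).1
  have h𝔞 : ∀ x : U, x ∈ 𝔞 → (x : T) ∈ U' := fun x hx =>
    (hmemU' _).2 ⟨x.2, by rw [Ideal.Quotient.eq_zero_iff_mem.2 hx]; exact F.zero_mem⟩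
  have hpU : ∀ u ∈ U, p * u ∈ U' := fun u hu =>
    h𝔞 (p * ⟨u, hu⟩) (Ideal.mul_mem_right _ _ (Ideal.mem_sup_right
      (Ideal.mem_span_singleton_self _)))
  have hsurj : ∀ y, ∃ x ∈ U', θ x = y := fun y => by
    obtain ⟨c, hc, rfl⟩ := hFs y
    obtain ⟨x, rfl⟩ := Ideal.Quotient.mk_surjective c
    exact ⟨x, (hmemU' _).2 ⟨x.2, hc⟩, rfl⟩
  have hJU : ∀ x ∈ J (n + 1), x ∈ U := fun x hx => hU.le x (hanti (by omega) hx)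
  have hreduce : ∀ u ∈ U, ∃ u' ∈ U', ∃ v ∈ U, p * u - p * u' - p ^ 2 * v ∈ J (n + 1) := by
    intro u hu
    obtain ⟨u', hu', h⟩ := hsurj (θ u)
    obtain ⟨v, hv, hj⟩ := hU.ker (u - u') (sub_mem hu (hle hu')) (by rw [map_sub, h, sub_self])
    refine ⟨u', hu', v, hv, ?_⟩
    have := hpJ' _ _ hj
    ring_nf at this ⊢
    exact this
  have hiter : ∀ i, ∀ u ∈ U, ∃ u' ∈ U', ∃ v ∈ U,
      p * u - p * u' - p ^ (i + 1) * v ∈ J (n + 1) := by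
    intro i u hu
    induction i with
    | zero => exact ⟨0, U'.zero_mem, u, hu, by simp⟩
    | succ i ih =>
      obtain ⟨u', hu', v, hv, h⟩ := ih
      obtain ⟨v', hv', w, hw, h'⟩ := hreduce v hv
      refine ⟨u' + p ^ i * v', add_mem hu' (mul_mem (pow_mem (natCast_mem _ _) _) hv'), w, hw, ?_⟩
      have := add_mem h (Ideal.mul_mem_left _ ((p : T) ^ i) h')
      ring_nf at this ⊢
      exact this
  refine ⟨U', hle, ⟨hsurj, ?_, ?_⟩, hpU⟩
  · intro x hx h0
    obtain ⟨hxU, hxF⟩ := (hmemU' x).1 hx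
    obtain ⟨u, hu, hj⟩ := (hmem ⟨x, hxU⟩).1
      (Ideal.Quotient.eq_zero_iff_mem.1 (hF0 _ hxF h0))
    obtain ⟨u', hu', v, hv, h⟩ := hiter n u hu
    refine ⟨u', hu', ?_⟩
    have := add_mem (add_mem hj h) (Ideal.mul_mem_right v _ (hpow n))
    ring_nf at this ⊢
    exact this
  · intro x hx
    exact h𝔞 ⟨x, hJU x hx⟩ ((hmem _).2 ⟨0, U.zero_mem, by simpa using hx⟩)

/-- The intersection of a tower of stages is a coefficient ring. -/
theorem exists_coefficient_tower (hp0 : θ p = 0) (hpJ : (p : T) ∈ J 1)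
    (hmul : ∀ m n, J m * J n ≤ J (m + n)) (hanti : Antitone J) (hker : ∀ x, x ∈ J 1 ↔ θ x = 0)
    (hJ0 : J 0 = ⊤) (hθ : Function.Surjective θ)
    (hcomp : ∀ x : ℕ → T, (∀ i, x (i + 1) - x i ∈ J i) → ∃ v, ∀ i, v - x i ∈ J i)
    (hhaus : ∀ x, (∀ i, x ∈ J i) → x = 0)
    (L : ℕ → Ideal T) (hL : ∀ n (x : T), p * x ∈ L (n + 1) → x ∈ L n) (hL1 : ∀ x ∈ L 1, θ x = 0)
    (hLanti : Antitone L) (hJL : ∀ n, J n ≤ L n) :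
    ∃ V : Subring T, (∀ y, ∃ x ∈ V, θ x = y) ∧ (∀ x ∈ V, ∀ n, x ∈ L n → ∃ v ∈ V, x = p ^ n * v) ∧
      ∀ x : ℕ → T, (∀ i, x i ∈ V) → (∀ i, x (i + 1) - x i ∈ J i) →
        ∃ v ∈ V, ∀ i, v - x i ∈ J i := by
  have hpJ' : ∀ n, ∀ x ∈ J n, p * x ∈ J (n + 1) := fun n x hx => by
    rw [add_comm n 1]; exact hmul 1 n (Ideal.mul_mem_mul hpJ hx)
  have h0 : IsStage p θ J 1 ⊤ := ⟨fun y => (hθ y).imp fun x hx => ⟨trivial, hx⟩,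
    fun x _ hx => ⟨0, trivial, by simpa using (hker x).2 hx⟩, fun _ _ => trivial⟩
  choose! nx hnx1 hnx2 hnx3 using fun (n : ℕ) (U : Subring T) (h : IsStage p θ J (n + 1) U) =>
    h.exists_next hp0 hpJ hmul hanti (fun x => (hker x).1) (by omega)
  let U : ℕ → Subring T := fun n => Nat.rec ⊤ nx n
  have hU : ∀ n, IsStage p θ J (n + 1) (U n) := fun n => by
    induction n with
    | zero => exact h0
    | succ n ih => exact hnx2 n _ ih
  have hUle : ∀ n, U (n + 1) ≤ U n := fun n => hnx1 n _ (hU n)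
  have hUp : ∀ n, ∀ u ∈ U n, p * u ∈ U (n + 1) := fun n => hnx3 n _ (hU n)
  have hUanti : Antitone U := antitone_nat_of_succ_le hUle
  let V : Subring T := ⨅ n, U n
  have hV : ∀ x, x ∈ V ↔ ∀ n, x ∈ U n := fun x => Subring.mem_iInf
  have hlim : ∀ x : ℕ → T, (∀ i, x (i + 1) ∈ U i) → (∀ i, x (i + 1) - x i ∈ J i) →
      ∃ v ∈ V, ∀ i, v - x i ∈ J i := by
    intro x hx hc
    obtain ⟨v, hv⟩ := hcomp x hc
    refine ⟨v, (hV v).2 fun n => ?_, hv⟩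
    simpa using add_mem ((hU n).le _ (hv (n + 1))) (hx n)
  have hstep : ∀ n, ∀ x ∈ U n, ∃ y ∈ U (n + 1), y - x ∈ J (n + 1) := by
    intro n x hx
    obtain ⟨y, hy, hyx⟩ := (hU (n + 1)).surj (θ x)
    obtain ⟨u, hu, hj⟩ := (hU n).ker (x - y) (sub_mem hx (hUle n hy))
      (by rw [map_sub, hyx, sub_self])
    refine ⟨y + p * u, add_mem hy (hUp n u hu), ?_⟩
    have := neg_mem hj
    ring_nf at this ⊢
    exact this
  choose! st hst1 hst2 using hstep
  have happrox : ∀ n, ∀ x ∈ U n, ∃ v ∈ V, v - x ∈ J (n + 1) := by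
    intro n x hx
    let y : ℕ → T := fun i => Nat.rec x (fun i z => st (n + i) z) i
    have hy : ∀ i, y i ∈ U (n + i) := fun i => by
      induction i with
      | zero => exact hx
      | succ i ih => exact hst1 (n + i) _ ih
    have hys : ∀ i, y (i + 1) - y i ∈ J (n + i + 1) := fun i => hst2 (n + i) _ (hy i)
    have hyx : ∀ i, y i - x ∈ J (n + 1) := fun i => by
      induction i with
      | zero => simp [y]
      | succ i ih =>
        have := add_mem (hanti (by omega) (hys i)) ih
        simpa using this
    obtain ⟨v, hv, hvy⟩ := hlim y (fun i => hUanti (show i ≤ n + (i + 1) by omega) (hy (i + 1)))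
      fun i => hanti (show i ≤ n + i + 1 by omega) (hys i)
    refine ⟨v, hv, ?_⟩
    simpa using add_mem (hvy (n + 1)) (hyx (n + 1))
  have hdiv : ∀ x ∈ V, θ x = 0 → ∀ n, ∃ v ∈ V, x - p * v ∈ J (n + 1) := by
    intro x hx h0 n
    obtain ⟨u, hu, hj⟩ := (hU n).ker x ((hV x).1 hx n) h0
    obtain ⟨v, hv, hvu⟩ := happrox n u hu
    refine ⟨v, hv, ?_⟩
    have := sub_mem hj (Ideal.mul_mem_left _ (p : T) hvu)
    ring_nf at this ⊢
    exact this
  have hVL : ∀ n, ∀ x ∈ V, x ∈ L n → x ∈ J n := by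
    intro n
    induction n with
    | zero => intro x _ _; rw [hJ0]; trivial
    | succ n ih =>
      intro x hx hxL
      obtain ⟨v, hv, hj⟩ := hdiv x hx (hL1 x (hLanti (by omega) hxL)) n
      have hvL : v ∈ L n := hL n v (by simpa using sub_mem hxL (hJL _ hj))
      simpa using add_mem hj (hpJ' n v (ih v hv hvL))
  have hpV : ∀ x ∈ V, θ x = 0 → ∃ v ∈ V, x = p * v := by
    intro x hx h0
    choose v hv hj using hdiv x hx h0
    have hc : ∀ i, v (i + 1) - v i ∈ J i := fun i => by
      refine hVL i _ (sub_mem (hv _) (hv _)) (hL i _ (hJL _ ?_))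
      have := sub_mem (hj i) (hanti (by omega) (hj (i + 1)))
      ring_nf at this ⊢
      exact this
    obtain ⟨w, hw, hwv⟩ := hlim v (fun i => (hV _).1 (hv _) _) hc
    refine ⟨w, hw, sub_eq_zero.1 (hhaus _ fun i => ?_)⟩
    have h := sub_mem (hanti (Nat.le_succ i) (hj i)) (Ideal.mul_mem_left _ (p : T) (hwv i))
    have e : x - p * v i - p * (w - v i) = x - p * w := by ring
    exact e ▸ h
  refine ⟨V, fun y => ?_, fun x hx n => ?_, fun x hx hc =>
    hlim x (fun i => (hV _).1 (hx _) _) hc⟩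
  · obtain ⟨x, rfl⟩ := hθ y
    obtain ⟨v, hv, hj⟩ := happrox 0 x trivial
    refine ⟨v, hv, ?_⟩
    rw [← sub_eq_zero, ← map_sub]
    exact (hker _).1 hj
  · induction n generalizing x with
    | zero => exact fun _ => ⟨x, hx, by simp⟩
    | succ n ih =>
      intro hxL
      obtain ⟨v, hv, rfl⟩ := hpV x hx (hL1 x (hLanti (by omega) hxL))
      obtain ⟨w, hw, rfl⟩ := ih v hv (hL n v hxL)
      exact ⟨w, hw, by ring⟩

end Tower

end CoefficientRing

section CoefficientDVR

theorem exists_limit {A : Type*} [CommRing A] (I : Ideal A) [IsPrecomplete I A] (x : ℕ → A)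
    (h : ∀ i, x (i + 1) - x i ∈ I ^ i) : ∃ v, ∀ i, v - x i ∈ I ^ i := by
  have hmn : ∀ m j, x (m + j) - x m ∈ I ^ m := fun m j => by
    induction j with
    | zero => simp
    | succ j ih =>
      have := add_mem (Ideal.pow_le_pow_right (show m ≤ m + j by omega) (h (m + j))) ih
      simpa [← add_assoc] using this
  obtain ⟨v, hv⟩ := IsPrecomplete.prec (I := I) inferInstance (f := x) fun {m n} hmn' => by
    obtain ⟨j, rfl⟩ := Nat.exists_eq_add_of_le hmn'
    rw [SModEq.comm, SModEq.sub_mem]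
    simpa using hmn m j
  refine ⟨v, fun i => ?_⟩
  have := (hv i).symm
  rw [SModEq.sub_mem] at this
  simpa using this

theorem eq_zero_of_forall_mem_pow {A : Type*} [CommRing A] (I : Ideal A) [IsHausdorff I A] {x : A}
    (h : ∀ i, x ∈ I ^ i) : x = 0 :=
  IsHausdorff.haus (I := I) inferInstance x fun i => by
    rw [SModEq.zero]
    simpa using h i

theorem isAdicComplete_of_exists_limit {A : Type*} [CommRing A] (I : Ideal A)
    (h : ∀ x : ℕ → A, (∀ i, x (i + 1) - x i ∈ I ^ i) → ∃ v, ∀ i, v - x i ∈ I ^ i)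
    (h0 : ∀ x, (∀ i, x ∈ I ^ i) → x = 0) : IsAdicComplete I A where
  haus' x hx := h0 x fun i => by
    have := hx i
    rw [SModEq.zero] at this
    simpa using this
  prec' x hx := by
    obtain ⟨v, hv⟩ := h x fun i => by
      have := (hx (Nat.le_succ i)).symm
      rw [SModEq.sub_mem] at this
      simpa using this
    refine ⟨v, fun i => ?_⟩
    rw [SModEq.comm, SModEq.sub_mem]
    simpa using hv i

theorem isDiscreteValuationRing_of_isAdicComplete {V k : Type*} [CommRing V] [IsDomain V]
    [Field k] (θ : V →+* k) {ϖ : V} (h0 : ϖ ≠ 0) (hθ : Function.Surjective θ)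
    (hker : ∀ x, θ x = 0 ↔ ϖ ∣ x) [IsAdicComplete (Ideal.span {ϖ}) V] :
    ∃ _ : IsDiscreteValuationRing V, maximalIdeal V = Ideal.span {ϖ} := by
  have hunit : ∀ x, θ x ≠ 0 → IsUnit x := fun x hx => by
    obtain ⟨y, hy⟩ := hθ (θ x)⁻¹
    have h1 : ϖ ∣ x * y - 1 := (hker _).1 (by rw [map_sub, map_mul, hy, mul_inv_cancel₀ hx]; simp)
    have h2 : x * y - 1 ∈ (⊥ : Ideal V).jacobson :=
      IsAdicComplete.le_jacobson_bot (Ideal.span {ϖ}) (Ideal.mem_span_singleton.2 h1)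
    have h3 := Ideal.mem_jacobson_bot.1 h2 1
    exact isUnit_of_mul_isUnit_left (by simpa using h3)
  have hnu : ∀ x, ϖ ∣ x → ¬ IsUnit x := fun x hx hu => by
    have := hu.map θ
    rw [(hker x).2 hx] at this
    exact not_isUnit_zero this
  have hirr : Irreducible ϖ := by
    refine (Ideal.span_singleton_prime h0).1 ?_ |>.irreducible
    have : Ideal.span {ϖ} = RingHom.ker θ := by
      ext x
      rw [Ideal.mem_span_singleton, RingHom.mem_ker, hker]
    rw [this]
    exact RingHom.ker_isPrime θ
  have hdvr : IsDiscreteValuationRing V := by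
    refine IsDiscreteValuationRing.ofHasUnitMulPowIrreducibleFactorization ⟨ϖ, hirr, ?_⟩
    intro x hx
    by_contra! hcon
    refine hx (eq_zero_of_forall_mem_pow (Ideal.span {ϖ}) fun i => ?_)
    rw [Ideal.span_singleton_pow, Ideal.mem_span_singleton]
    induction i with
    | zero => simp
    | succ i ih =>
      obtain ⟨u, rfl⟩ := ih
      by_cases hu : θ u = 0
      · obtain ⟨w, rfl⟩ := (hker u).1 hu
        exact ⟨w, by ring⟩
      · exact absurd (associated_mul_unit_right _ _ (hunit u hu)) (hcon i)
  exact ⟨hdvr, hirr.maximalIdeal_eq⟩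

theorem isDiscreteValuationRing_subring {T W k : Type*} [CommRing T] [CommRing W] [IsDomain W]
    [Field k] (p : T) (J : ℕ → Ideal T) (V : Subring T) (hpV : p ∈ V)
    (hJ : ∀ x ∈ V, ∀ n, x ∈ J n ↔ ∃ v ∈ V, x = p ^ n * v)
    (hhaus : ∀ x, (∀ i, x ∈ J i) → x = 0)
    (hlim : ∀ x : ℕ → T, (∀ i, x i ∈ V) → (∀ i, x (i + 1) - x i ∈ J i) →
        ∃ v ∈ V, ∀ i, v - x i ∈ J i)
    (ι : T →+* W) (hιp : ι p ≠ 0) (hι : ∀ x ∈ V, ι x = 0 → ∀ n, ∃ v ∈ V, x = p ^ n * v)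
    (θ : T →+* k) (hθ : ∀ y, ∃ x ∈ V, θ x = y) (hker : ∀ x, x ∈ J 1 ↔ θ x = 0) :
    ∃ (_ : IsDomain V) (_ : IsDiscreteValuationRing V),
      maximalIdeal V = Ideal.span {⟨p, hpV⟩} ∧ IsAdicComplete (maximalIdeal V) V := by
  let P : V := ⟨p, hpV⟩
  have hPJ : ∀ i (x : V), x ∈ Ideal.span {P} ^ i ↔ (x : T) ∈ J i := fun i x => by
    rw [Ideal.span_singleton_pow, Ideal.mem_span_singleton, hJ x x.2]
    constructor
    · rintro ⟨y, rfl⟩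
      exact ⟨y, y.2, rfl⟩
    · rintro ⟨v, hv, h⟩
      exact ⟨⟨v, hv⟩, Subtype.ext h⟩
  have hinj : Function.Injective (ι.comp V.subtype) := by
    rw [injective_iff_map_eq_zero]
    exact fun x hx => Subtype.ext (hhaus x fun i => (hJ x x.2 i).2 (hι x x.2 hx i))
  have hdom : IsDomain V := hinj.isDomain (ι.comp V.subtype)
  have hcomp : IsAdicComplete (Ideal.span {P}) V := by
    refine isAdicComplete_of_exists_limit _ (fun x hx => ?_) fun x hx =>
      Subtype.ext (hhaus x fun i => (hPJ i x).1 (hx i))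
    obtain ⟨v, hv, h⟩ := hlim (fun i => (x i : T)) (fun i => (x i).2) fun i =>
      (hPJ i (x (i + 1) - x i)).1 (hx i)
    exact ⟨⟨v, hv⟩, fun i => (hPJ i (⟨v, hv⟩ - x i)).2 (h i)⟩
  have hP0 : P ≠ 0 := fun h => hιp (by
    have : p = 0 := congrArg Subtype.val h
    rw [this, map_zero])
  obtain ⟨hdvr, hmax⟩ := isDiscreteValuationRing_of_isAdicComplete (θ.comp V.subtype) hP0
    (fun y => by
      obtain ⟨x, hx, h⟩ := hθ y
      exact ⟨⟨x, hx⟩, h⟩)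
    (fun x => by
      rw [← Ideal.mem_span_singleton, ← pow_one (Ideal.span _), hPJ, hker]
      rfl)
  exact ⟨hdom, hdvr, hmax, by rw [hmax]; exact hcomp⟩

theorem exists_coefficient_dvr_of_charP {A : Type} [CommRing A] [IsLocalRing A]
    [IsAdicComplete (maximalIdeal A) A] (p : ℕ) [hp : Fact p.Prime]
    [CharP (ResidueField A) p] :
    ∃ (V : Type) (_ : CommRing V) (_ : IsDomain V) (_ : IsDiscreteValuationRing V) (φ : V →+* A),
      IsAdicComplete (maximalIdeal V) V ∧ (∀ v ∈ maximalIdeal V, φ v ∈ maximalIdeal A) ∧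
      ∀ a, ∃ v, a - φ v ∈ maximalIdeal A := by
  let k := ResidueField A
  let K := PerfectClosure k p
  let W := WittVector p K
  let T : Subring (W × A) := RingHom.eqLocus
    ((WittVector.constantCoeff : W →+* K).comp (RingHom.fst W A))
    (((PerfectClosure.of k p).comp (residue A)).comp (RingHom.snd W A))
  have hT : ∀ x : W × A, x ∈ T ↔
    WittVector.constantCoeff x.1 = PerfectClosure.of k p (residue A x.2) := fun x => Iff.rfl
  let 𝔭 : Ideal W := Ideal.span {(p : W)}
  let J : ℕ → Ideal T := fun n =>
    (Ideal.prod (𝔭 ^ n) (maximalIdeal A ^ n)).comap T.subtype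
  have hJ : ∀ n (x : T), x ∈ J n ↔ x.1.1 ∈ 𝔭 ^ n ∧ x.1.2 ∈ maximalIdeal A ^ n :=
    fun n x => Iff.rfl
  let L : ℕ → Ideal T := fun n => (𝔭 ^ n).comap ((RingHom.fst W A).comp T.subtype)
  have hL : ∀ n (x : T), x ∈ L n ↔ x.1.1 ∈ 𝔭 ^ n := fun n x => Iff.rfl
  have hW : IsAdicComplete 𝔭 W := WittVector.isAdicCompleteIdealSpanP
  have hkerW : ∀ w : W, w ∈ 𝔭 ↔ WittVector.constantCoeff w = 0 := fun w => by
    rw [← RingHom.mem_ker, WittVector.ker_constantCoeff]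
  let θ : T →+* k := (residue A).comp ((RingHom.snd W A).comp T.subtype)
  have hθ0 : ∀ x : T, θ x = 0 ↔ x.1.2 ∈ maximalIdeal A := fun x => residue_eq_zero_iff _
  have h1p : ∀ x : T, θ x = 0 ↔ x.1.1 ∈ 𝔭 := fun x => by
    rw [hkerW, (hT x.1).1 x.2,
      map_eq_zero_iff _ (RingHom.injective (PerfectClosure.of k p : k →+* K))]
    rfl
  have hpA : (p : A) ∈ maximalIdeal A := by
    rw [← residue_eq_zero_iff, map_natCast]
    exact CharP.cast_eq_zero k p
  have hker : ∀ x, x ∈ J 1 ↔ θ x = 0 := fun x => by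
    rw [hJ, pow_one, pow_one, ← hθ0, ← h1p, and_self]
  have hθp : θ p = 0 := by rw [map_natCast]; exact CharP.cast_eq_zero k p
  have hpW : (p : W) ≠ 0 := WittVector.p_nonzero p K
  obtain ⟨V, hVs, hVL, hVc⟩ := exists_coefficient_tower (p := p) (θ := θ) (J := J) hθp
    ((hker _).2 hθp)
    (fun m n => Ideal.mul_le.2 fun x hx y hy => by
      rw [hJ, pow_add, pow_add]
      exact ⟨Ideal.mul_mem_mul hx.1 hy.1, Ideal.mul_mem_mul hx.2 hy.2⟩)
    (fun m n hmn x hx => ⟨Ideal.pow_le_pow_right hmn hx.1, Ideal.pow_le_pow_right hmn hx.2⟩)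
    hker
    (by ext x; simp [hJ])
    (fun y => by
      obtain ⟨a, rfl⟩ := residue_surjective y
      obtain ⟨w, hw⟩ := WittVector.constantCoeff_surjective (p := p)
        (PerfectClosure.of k p (residue A a))
      exact ⟨⟨(w, a), hw⟩, rfl⟩)
    (fun x hx => by
      obtain ⟨w, hw⟩ := exists_limit 𝔭 (fun i => (x i).1.1) fun i => (hx i).1
      obtain ⟨a, ha⟩ := exists_limit (maximalIdeal A) (fun i => (x i).1.2) fun i => (hx i).2
      have h1 := (hkerW _).1 (by simpa using hw 1)
      have h2 := (residue_eq_zero_iff _).2 (by simpa only [pow_one] using ha 1)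
      have h3 : (w, a) ∈ T := by
        rw [hT]
        rw [map_sub, sub_eq_zero] at h1 h2
        rw [h1, h2]
        exact (x 1).2
      exact ⟨⟨(w, a), h3⟩, fun i => ⟨hw i, ha i⟩⟩)
    (fun x hx => Subtype.ext (Prod.ext (eq_zero_of_forall_mem_pow 𝔭 fun i => (hx i).1)
      (eq_zero_of_forall_mem_pow (maximalIdeal A) fun i => (hx i).2)))
    L
    (fun n x hx => by
      rw [hL, Ideal.span_singleton_pow, Ideal.mem_span_singleton] at hx ⊢
      obtain ⟨w, hw⟩ := hx
      refine ⟨w, mul_left_cancel₀ hpW ?_⟩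
      rw [← mul_assoc, ← pow_succ']
      exact hw)
    (fun x hx => by rw [h1p]; simpa [hL] using hx)
    (fun m n hmn x hx => Ideal.pow_le_pow_right hmn hx)
    (fun n x hx => hx.1)
  have hmemJ : ∀ x ∈ V, ∀ n, x ∈ J n ↔ ∃ v ∈ V, x = p ^ n * v := fun x hx n => by
    constructor
    · exact fun h => hVL x hx n h.1
    · rintro ⟨v, -, rfl⟩
      exact Ideal.mul_mem_right _ _ ⟨Ideal.pow_mem_pow (Ideal.mem_span_singleton_self _) n,
        Ideal.pow_mem_pow hpA n⟩
  obtain ⟨hdom, hdvr, hmax, hcomp⟩ := isDiscreteValuationRing_subring (k := k) (p : T) J V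
    (natCast_mem V p) hmemJ
    (fun x hx => Subtype.ext (Prod.ext (eq_zero_of_forall_mem_pow 𝔭 fun i => (hx i).1)
      (eq_zero_of_forall_mem_pow (maximalIdeal A) fun i => (hx i).2)))
    hVc ((RingHom.fst W A).comp T.subtype) (by rw [map_natCast]; exact hpW)
    (fun x hx h n => hVL x hx n (by rw [hL]; exact (show x.1.1 = 0 from h) ▸ zero_mem _))
    θ hVs hker
  have hm : ∀ v ∈ maximalIdeal V, (v : T) ∈ J 1 := fun v hv => by
    rw [hmax, Ideal.mem_span_singleton] at hv
    obtain ⟨w, rfl⟩ := hv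
    exact (hmemJ _ (SetLike.coe_mem _) 1).2 ⟨w, w.2, by rw [pow_one]; rfl⟩
  refine ⟨V, inferInstance, hdom, hdvr, (RingHom.snd W A).comp (T.subtype.comp V.subtype),
    hcomp, fun v hv => (hθ0 _).1 ((hker _).1 (hm v hv)), fun a => ?_⟩
  · obtain ⟨x, hx, h⟩ := hVs (residue A a)
    refine ⟨⟨x, hx⟩, ?_⟩
    rw [← residue_eq_zero_iff, map_sub, sub_eq_zero]
    exact h.symm

theorem exists_coefficient_dvr_of_charZero {A : Type} [CommRing A] [IsLocalRing A]
    [IsAdicComplete (maximalIdeal A) A] [CharZero (ResidueField A)] :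
    ∃ (V : Type) (_ : CommRing V) (_ : IsDomain V) (_ : IsDiscreteValuationRing V) (φ : V →+* A),
      IsAdicComplete (maximalIdeal V) V ∧ (∀ v ∈ maximalIdeal V, φ v ∈ maximalIdeal A) ∧
      ∀ a, ∃ v, a - φ v ∈ maximalIdeal A := by
  let k := ResidueField A
  have hn : ∀ n : ℕ, n ≠ 0 → IsUnit (n : A) := fun n hn => by
    by_contra h
    have h1 : (n : k) = 0 := by
      rw [← map_natCast (residue A), residue_eq_zero_iff]
      exact h
    exact hn (Nat.cast_eq_zero.1 h1)
  let _ : Algebra ℚ A := (IsLocalization.lift (M := nonZeroDivisors ℤ) (g := Int.castRingHom A)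
    fun y => by
      have h := hn y.1.natAbs (Int.natAbs_ne_zero.2 (nonZeroDivisors.ne_zero y.2))
      rcases Int.natAbs_eq y.1 with h' | h'
      · rw [h']; simpa using h
      · rw [h']; simpa using h).toAlgebra
  let _ : Algebra ℚ k := Ideal.instAlgebraQuotient ℚ (maximalIdeal A)
  have : Algebra.FormallySmooth ℚ k := by
    obtain ⟨s, hs⟩ := exists_isTranscendenceBasis ℚ k
    have := hs.isAlgebraic_field
    exact .of_algebraicIndependent_of_isSeparable hs.1
  obtain ⟨g, hg⟩ := Algebra.FormallySmooth.exists_mkₐ_comp_eq_of_isAdicComplete (R := ℚ) (A := k)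
    (I := maximalIdeal A) (AlgHom.id ℚ k)
  have hg' : ∀ y, residue A (g y) = y := fun y => DFunLike.congr_fun hg y
  have hmax : maximalIdeal (PowerSeries k) = Ideal.span {PowerSeries.X} :=
    PowerSeries.X_irreducible.maximalIdeal_eq
  refine ⟨PowerSeries k, inferInstance, inferInstance, inferInstance,
    (g : k →+* A).comp PowerSeries.constantCoeff, by rw [hmax]; infer_instance,
    fun v hv => ?_, fun a => ⟨PowerSeries.C (residue A a), ?_⟩⟩
  · rw [hmax, Ideal.mem_span_singleton, PowerSeries.X_dvd_iff] at hv
    simp [hv]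
  · rw [← residue_eq_zero_iff, map_sub, sub_eq_zero]
    simp [hg']

/-- A weak form of the Cohen structure theorem: complete local rings receive a map from a
complete discrete valuation ring which is surjective on residue fields. -/
theorem exists_coefficient_dvr {A : Type} [CommRing A] [IsLocalRing A]
    [IsAdicComplete (maximalIdeal A) A] :
    ∃ (V : Type) (_ : CommRing V) (_ : IsDomain V) (_ : IsDiscreteValuationRing V) (φ : V →+* A),
      IsAdicComplete (maximalIdeal V) V ∧ (∀ v ∈ maximalIdeal V, φ v ∈ maximalIdeal A) ∧
      ∀ a, ∃ v, a - φ v ∈ maximalIdeal A := by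
  obtain ⟨p, hp⟩ := CharP.exists (ResidueField A)
  rcases CharP.char_is_prime_or_zero (ResidueField A) p with h | rfl
  · have : Fact p.Prime := ⟨h⟩
    exact exists_coefficient_dvr_of_charP p
  · have := CharP.charP_to_charZero (ResidueField A)
    exact exists_coefficient_dvr_of_charZero

end CoefficientDVR

section PowerSeriesLift

section PowerSeriesLift

open PowerSeries

theorem X_pow_dvd_sub_trunc {B : Type*} [CommRing B] (g : B⟦X⟧) (i : ℕ) :
    (X : B⟦X⟧) ^ i ∣ g - (trunc i g : Polynomial B) := by
  rw [X_pow_dvd_iff]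
  intro m hm
  rw [map_sub, Polynomial.coeff_coe, coeff_trunc, if_pos hm, sub_self]

theorem exists_powerSeries_lift {B A : Type*} [CommRing B] [CommRing A] (J : Ideal A)
    [IsAdicComplete J A] (φ : B →+* A) {a : A} (ha : a ∈ J) :
    ∃ Φ : B⟦X⟧ →+* A, (∀ b, Φ (C b) = φ b) ∧ Φ X = a := by
  have hpoly : ∀ (P : Polynomial B) i, (X : B⟦X⟧) ^ i ∣ P → P.eval₂ φ a ∈ J ^ i := by
    intro P i h
    have h' : Polynomial.X ^ i ∣ P := by
      rw [Polynomial.X_pow_dvd_iff]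
      intro d hd
      simpa using X_pow_dvd_iff.1 h d hd
    obtain ⟨Q, rfl⟩ := h'
    rw [Polynomial.eval₂_mul, Polynomial.eval₂_X_pow]
    exact Ideal.mul_mem_right _ _ (Ideal.pow_mem_pow ha i)
  choose v hv using fun g : B⟦X⟧ => exists_limit J (fun i => (trunc i g).eval₂ φ a) fun i => by
    rw [← Polynomial.eval₂_sub]
    refine hpoly _ i ?_
    have h1 := X_pow_dvd_sub_trunc g i
    have h2 := (pow_dvd_pow (X : B⟦X⟧) (Nat.le_succ i)).trans (X_pow_dvd_sub_trunc g (i + 1))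
    have := dvd_sub h1 h2
    rw [sub_sub_sub_cancel_left] at this
    exact_mod_cast this
  have key : ∀ g i (P : Polynomial B), (X : B⟦X⟧) ^ i ∣ g - P → v g - P.eval₂ φ a ∈ J ^ i := by
    intro g i P h
    have h2 : (X : B⟦X⟧) ^ i ∣ ((trunc i g - P : Polynomial B) : B⟦X⟧) := by
      have := dvd_sub h (X_pow_dvd_sub_trunc g i)
      rw [sub_sub_sub_cancel_left] at this
      exact_mod_cast this
    have h3 := add_mem (hv g i) (hpoly _ i h2)
    rw [Polynomial.eval₂_sub] at h3
    simpa using h3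
  have key' : ∀ (P : Polynomial B), v P = P.eval₂ φ a := fun P =>
    sub_eq_zero.1 (eq_zero_of_forall_mem_pow J fun i => key _ i P (by simp))
  refine ⟨⟨⟨⟨v, ?_⟩, fun f g => ?_⟩, ?_, fun f g => ?_⟩, fun b => ?_, ?_⟩
  · simpa using key' 1
  · refine sub_eq_zero.1 (eq_zero_of_forall_mem_pow J fun i => ?_)
    have h1 := key (f * g) i (trunc i f * trunc i g) (by
      have h1 := (X_pow_dvd_sub_trunc f i).mul_right g
      have h2 := (X_pow_dvd_sub_trunc g i).mul_left (trunc i f : Polynomial B)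
      have := dvd_add h1 h2
      rw [Polynomial.coe_mul]
      ring_nf at this ⊢
      exact this)
    have h2 := Ideal.mul_mem_right (v g) _ (hv f i)
    have h3 := Ideal.mul_mem_left _ ((trunc i f).eval₂ φ a) (hv g i)
    have := sub_mem h1 (add_mem h2 h3)
    rw [Polynomial.eval₂_mul] at this
    ring_nf at this ⊢
    exact this
  · simpa using key' 0
  · refine sub_eq_zero.1 (eq_zero_of_forall_mem_pow J fun i => ?_)
    have h1 := key (f + g) i (trunc i f + trunc i g) (by
      have := dvd_add (X_pow_dvd_sub_trunc f i) (X_pow_dvd_sub_trunc g i)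
      rw [Polynomial.coe_add]
      ring_nf at this ⊢
      exact this)
    have := sub_mem h1 (add_mem (hv f i) (hv g i))
    rw [Polynomial.eval₂_add] at this
    ring_nf at this ⊢
    exact this
  · simpa using key' (Polynomial.C b)
  · simpa using key' Polynomial.X

theorem powerSeries_ringHom_ext {B A : Type*} [CommRing B] [CommRing A] (J : Ideal A)
    [IsHausdorff J A] {Φ Ψ : B⟦X⟧ →+* A} (hC : ∀ b, Φ (C b) = Ψ (C b)) (hX : Φ X = Ψ X)
    (hJ : Φ X ∈ J) : Φ = Ψ := by
  ext g
  refine sub_eq_zero.1 (eq_zero_of_forall_mem_pow J fun i => ?_)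
  obtain ⟨q, hq⟩ := X_pow_dvd_sub_trunc g i
  have hP : ∀ P : Polynomial B, Φ P = Ψ P := fun P => by
    have : Φ.comp (Polynomial.coeToPowerSeries.ringHom) =
        Ψ.comp (Polynomial.coeToPowerSeries.ringHom) := by
      ext b
      · simpa using hC b
      · simpa using hX
    simpa using DFunLike.congr_fun this P
  rw [sub_eq_iff_eq_add] at hq
  rw [hq, map_add, map_add, map_mul, map_mul, map_pow, map_pow, hP, add_sub_add_right_eq_sub,
    ← hX, ← mul_sub]
  exact Ideal.mul_mem_right _ _ (Ideal.pow_mem_pow hJ i)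

end PowerSeriesLift

section FiniteModulo

/-- `A ⧸ K` is generated by finitely many elements over the image of `φ`. -/
def FiniteModulo {B A : Type*} [CommRing B] [CommRing A] (φ : B →+* A) (K : Ideal A) : Prop :=
  ∃ (n : ℕ) (s : Fin n → A), ∀ y, ∃ b : Fin n → B, y - ∑ i, φ (b i) * s i ∈ K

variable {B A : Type*} [CommRing B] [CommRing A]

theorem FiniteModulo.finite {φ : B →+* A} (h : FiniteModulo φ ⊥) : φ.Finite := by
  obtain ⟨n, s, hs⟩ := h
  let _ := φ.toAlgebra
  change Module.Finite B A
  refine Module.Finite.of_surjective (Fintype.linearCombination B s) fun y => ?_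
  obtain ⟨b, hb⟩ := hs y
  refine ⟨b, ?_⟩
  rw [Ideal.mem_bot, sub_eq_zero] at hb
  rw [hb, Fintype.linearCombination_apply]
  rfl

theorem finiteModulo_pow {φ : B →+* A} {m : Ideal A} (hm : m.FG)
    (hφ : ∀ a, ∃ b, a - φ b ∈ m) (N : ℕ) : FiniteModulo φ (m ^ N) := by
  induction N with
  | zero => exact ⟨0, Fin.elim0, fun y => ⟨Fin.elim0, by simp⟩⟩
  | succ N ih =>
    obtain ⟨n, s, hs⟩ := ih
    obtain ⟨k, t, ht⟩ := Submodule.fg_iff_exists_fin_generating_family.1 (hm.pow (n := N))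
    refine ⟨n + k, Fin.append s t, fun y => ?_⟩
    obtain ⟨b, hb⟩ := hs y
    rw [← ht, Submodule.mem_span_range_iff_exists_fun] at hb
    obtain ⟨c, hc⟩ := hb
    choose d hd using fun i => hφ (c i)
    refine ⟨Fin.append b d, ?_⟩
    rw [Fin.sum_univ_add]
    simp only [Fin.append_left, Fin.append_right]
    rw [← sub_sub, ← hc, ← Finset.sum_sub_distrib]
    refine Ideal.sum_mem _ fun i _ => ?_
    rw [smul_eq_mul, ← sub_mul, mul_comm, pow_succ]
    exact Ideal.mul_mem_mul (ht ▸ Submodule.subset_span ⟨i, rfl⟩) (hd i)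

theorem FiniteModulo.mono {φ : B →+* A} {K K' : Ideal A} (h : FiniteModulo φ K) (hK : K ≤ K') :
    FiniteModulo φ K' := by
  obtain ⟨n, s, hs⟩ := h
  exact ⟨n, s, fun y => (hs y).imp fun b hb => hK hb⟩

open PowerSeries in
theorem FiniteModulo.powerSeries [IsLocalRing A] [IsNoetherianRing A] {Φ : B⟦X⟧ →+* A}
    {K : Ideal A} (hX : Φ X ∈ maximalIdeal A)
    (h : FiniteModulo (Φ.comp C) (Ideal.span {Φ X} ⊔ K)) : FiniteModulo Φ K := by
  obtain ⟨n, s, hs⟩ := h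
  choose b hb using hs
  have hr : ∀ y, ∃ z, y - ∑ i, Φ (C (b y i)) * s i - Φ X * z ∈ K := fun y => by
    obtain ⟨u, hu, k, hk, h⟩ := Submodule.mem_sup.1 (hb y)
    obtain ⟨z, rfl⟩ := Ideal.mem_span_singleton'.1 hu
    have h' : y - ∑ i, Φ (C (b y i)) * s i = z * Φ X + k := h.symm
    exact ⟨z, by rwa [h', mul_comm, add_sub_cancel_left]⟩
  choose r hr using hr
  let g : A → Fin n → B⟦X⟧ := fun y i => PowerSeries.mk fun k => b (r^[k] y) i
  have hg : ∀ y i, g y i = C (b y i) + X * g (r y) i := fun y i => by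
    ext k
    rcases k with _ | k
    · simp [g]
    · rw [map_add, coeff_succ_X_mul]
      simp [g]
  have key : ∀ j y, ∃ z, y - ∑ i, Φ (g y i) * s i - Φ X ^ j * z ∈ K := by
    intro j
    induction j with
    | zero => exact fun y => ⟨y - ∑ i, Φ (g y i) * s i, by simp⟩
    | succ j ih =>
      intro y
      obtain ⟨z, hz⟩ := ih (r y)
      refine ⟨z, ?_⟩
      have := add_mem (hr y) (Ideal.mul_mem_left _ (Φ X) hz)
      have e : ∑ i, Φ (g y i) * s i =
          ∑ i, Φ (C (b y i)) * s i + Φ X * ∑ i, Φ (g (r y) i) * s i := by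
        rw [Finset.mul_sum, ← Finset.sum_add_distrib]
        refine Finset.sum_congr rfl fun i _ => ?_
        rw [hg, map_add, map_mul]
        ring
      rw [e]
      ring_nf at this ⊢
      exact this
  refine ⟨n, s, fun y => ⟨g y, ?_⟩⟩
  by_cases hK : K = ⊤
  · rw [hK]; trivial
  have : IsHausdorff (maximalIdeal A) (A ⧸ K) := inferInstance
  rw [← Ideal.Quotient.eq_zero_iff_mem]
  refine IsHausdorff.haus this _ fun j => ?_
  rw [SModEq.zero]
  obtain ⟨z, hz⟩ := key j y
  rw [Ideal.Quotient.mk_eq_mk_iff_sub_mem _ _ |>.2 hz]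
  have : Ideal.Quotient.mk K (Φ X ^ j * z) = Φ X ^ j • Ideal.Quotient.mk K z := rfl
  rw [this]
  exact Submodule.smul_mem_smul (Ideal.pow_mem_pow hX j) trivial

end FiniteModulo

end PowerSeriesLift

section GorensteinSequence

open RingTheory.Sequence

theorem map_mem_maximalIdeal_iff_of_surjective {B S : Type*} [CommRing B] [CommRing S]
    [IsLocalRing B] [IsLocalRing S] {ρ : B →+* S} (hρ : Function.Surjective ρ) (x : B) :
    ρ x ∈ maximalIdeal S ↔ x ∈ maximalIdeal B := by
  have hloc : IsLocalHom ρ := .of_surjective ρ hρ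
  simp [mem_maximalIdeal, mem_nonunits_iff]

theorem maximalIdeal_eq_map_of_surjective {B S : Type*} [CommRing B] [CommRing S]
    [IsLocalRing B] [IsLocalRing S] {ρ : B →+* S} (hρ : Function.Surjective ρ) :
    maximalIdeal S = (maximalIdeal B).map ρ := by
  refine le_antisymm (fun y hy => ?_) (Ideal.map_le_iff_le_comap.2 fun x hx =>
    (map_mem_maximalIdeal_iff_of_surjective hρ x).2 hx)
  obtain ⟨x, rfl⟩ := hρ y
  exact Ideal.mem_map_of_mem ρ ((map_mem_maximalIdeal_iff_of_surjective hρ x).1 hy)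

/-- A regular sequence of parameters generating an irreducible ideal, as witnessed by a
generator `σ` of the socle. -/
structure IsGorensteinSequence {S : Type*} [CommRing S] [IsLocalRing S] (rs : List S) : Prop where
  mem : ∀ x ∈ rs, x ∈ maximalIdeal S
  regular : IsRegular S rs
  pow_le : ∃ N, maximalIdeal S ^ N ≤ Ideal.ofList rs
  socle : ∃ σ ∉ Ideal.ofList rs, ∀ z ∉ Ideal.ofList rs, ∃ r, r * z - σ ∈ Ideal.ofList rs

section

variable {S : Type} [CommRing S] [IsLocalRing S] [IsNoetherianRing S] {rs : List S}

theorem IsGorensteinSequence.ringKrullDim_eq (h : IsGorensteinSequence rs) :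
    ringKrullDim S = rs.length := by
  obtain ⟨N, hN⟩ := h.pow_le
  refine le_antisymm (ringKrullDim_le_length h.mem hN) ?_
  obtain ⟨p, hp⟩ := associatedPrimes.nonempty S S
  exact (length_le_ringKrullDim_quotient rs h.regular.1 h.mem hp).trans
    (ringKrullDim_quotient_le p)

theorem isFiniteLength_quotient_of_pow_le {Q : Ideal S} {N : ℕ} (hN : maximalIdeal S ^ N ≤ Q) :
    IsFiniteLength S (S ⧸ Q • (⊤ : Submodule S S)) := by
  have hQ : Q • (⊤ : Submodule S S) = Q := by simp
  rw [hQ, isFiniteLength_iff_isNoetherian_isArtinian]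
  refine ⟨inferInstance, ?_⟩
  by_cases hT : Q = ⊤
  · have : Subsingleton (S ⧸ Q) := Ideal.Quotient.subsingleton_iff.2 hT
    infer_instance
  have : Nontrivial (S ⧸ Q) := Ideal.Quotient.nontrivial_iff.2 hT
  have : IsLocalRing (S ⧸ Q) := .of_surjective' _ Ideal.Quotient.mk_surjective
  have : IsArtinianRing (S ⧸ Q) := by
    rw [isArtinianRing_iff_isNilpotent_maximalIdeal]
    refine ⟨N, ?_⟩
    have hmap : maximalIdeal (S ⧸ Q) = (maximalIdeal S).map (Ideal.Quotient.mk Q) :=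
      maximalIdeal_eq_map_of_surjective Ideal.Quotient.mk_surjective
    rw [hmap, ← Ideal.map_pow, Ideal.zero_eq_bot, ← le_bot_iff, ← Ideal.map_quotient_self Q]
    exact Ideal.map_mono hN
  exact isArtinian_of_surjective_algebraMap (R := S ⧸ Q) Ideal.Quotient.mk_surjective

theorem IsGorensteinSequence.isGorensteinLocalRing (h : IsGorensteinSequence rs) :
    IsGorensteinLocalRing S := by
  have hd : mDim S S = rs.length := (mDim_self S).trans h.ringKrullDim_eq
  obtain ⟨N, hN⟩ := h.pow_le
  obtain ⟨σ, hσ, hs⟩ := h.socle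
  refine ⟨inferInstance, ⟨rs, h.mem, h.regular, hd.symm⟩, rs.length, Ideal.ofList rs, hd,
    ⟨Ideal.span_le.2 h.mem, ⟨rs.get, ?_⟩, isFiniteLength_quotient_of_pow_le hN⟩, ?_⟩
  · rw [Set.range_list_get]
  · intro I J hIJ
    by_contra! hcon
    have hle : Ideal.ofList rs ≤ I ∧ Ideal.ofList rs ≤ J := le_inf_iff.1 hIJ.le
    have key : ∀ I : Ideal S, Ideal.ofList rs ≤ I → Ideal.ofList rs ≠ I → σ ∈ I := by
      intro I h1 h2
      obtain ⟨z, hz, hz'⟩ := SetLike.exists_of_lt (lt_of_le_of_ne h1 h2)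
      obtain ⟨r, hr⟩ := hs z hz'
      have := sub_mem (I.mul_mem_left r hz) (h1 hr)
      rwa [sub_sub_cancel] at this
    exact hσ (hIJ ▸ ⟨key I hle.1 hcon.1, key J hle.2 hcon.2⟩)

end

theorem IsGorensteinSequence.perm {S : Type*} [CommRing S] [IsLocalRing S] [IsNoetherianRing S]
    {rs rs' : List S} (h : IsGorensteinSequence rs) (hp : rs.Perm rs') :
    IsGorensteinSequence rs' := by
  have e : Ideal.ofList rs' = Ideal.ofList rs := by
    unfold Ideal.ofList
    simp only [hp.mem_iff]
  exact ⟨fun x hx => h.mem x (hp.mem_iff.2 hx), IsLocalRing.isRegular_of_perm h.regular hp,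
    e ▸ h.pow_le, e ▸ h.socle⟩

section Quotient

open scoped Pointwise

variable {B S : Type*} [CommRing B] [CommRing S] {ρ : B →+* S} {h : B}
  {rs : List B}

theorem mem_ofList_map_iff (hρ : Function.Surjective ρ)
    (hker : RingHom.ker ρ = Ideal.span {h}) (z : B) :
    ρ z ∈ Ideal.ofList (rs.map ρ) ↔ z ∈ Ideal.ofList (h :: rs) := by
  rw [← Ideal.map_ofList, ← Ideal.mem_comap, Ideal.comap_map_of_surjective ρ hρ,
    Ideal.ofList_cons, ← hker, sup_comm]
  rfl

theorem isRegular_cons_iff_of_surjective (hρ : Function.Surjective ρ)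
    (hker : RingHom.ker ρ = Ideal.span {h}) :
    IsRegular B (h :: rs) ↔ IsSMulRegular B h ∧ IsRegular S (rs.map ρ) := by
  rw [isRegular_cons_iff]
  refine and_congr_right fun _ => ?_
  have hker' : (h • (⊤ : Submodule B B)).toAddSubgroup = ρ.toAddMonoidHom.ker := by
    ext x
    have : x ∈ Ideal.span {h} ↔ ρ x = 0 := by rw [← hker, RingHom.mem_ker]
    rw [Submodule.mem_toAddSubgroup, Submodule.mem_smul_pointwise_iff_exists, AddMonoidHom.mem_ker]
    change _ ↔ ρ x = 0
    rw [← this, Ideal.mem_span_singleton']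
    simp [mul_comm]
  let e : QuotSMulTop h B ≃+ S :=
    (QuotientAddGroup.quotientAddEquivOfEq hker').trans
      (QuotientAddGroup.quotientKerEquivOfSurjective ρ.toAddMonoidHom hρ)
  refine AddEquiv.isRegular_congr (e := e) (List.forall₂_map_right_iff.2
    (List.forall₂_same.2 fun r _ x => ?_))
  obtain ⟨x, rfl⟩ := Submodule.Quotient.mk_surjective _ x
  exact map_mul ρ r x

theorem isGorensteinSequence_cons_iff [IsLocalRing B] [IsLocalRing S]
    (hρ : Function.Surjective ρ)
    (hker : RingHom.ker ρ = Ideal.span {h}) :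
    IsGorensteinSequence (h :: rs) ↔ IsSMulRegular B h ∧ IsGorensteinSequence (rs.map ρ) := by
  have hmem := map_mem_maximalIdeal_iff_of_surjective hρ
  have hmap := maximalIdeal_eq_map_of_surjective hρ
  have hh0 : ρ h = 0 := by
    rw [← RingHom.mem_ker, hker]
    exact Ideal.mem_span_singleton_self h
  have hh : h ∈ maximalIdeal B := by
    rw [← hmem, hh0]
    exact zero_mem _
  have hl := mem_ofList_map_iff hρ hker (rs := rs)
  constructor
  · rintro ⟨h1, h2, ⟨N, hN⟩, σ, hσ, hs⟩
    obtain ⟨h0, hreg⟩ := (isRegular_cons_iff_of_surjective hρ hker).1 h2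
    refine ⟨h0, ?_, hreg, ⟨N, ?_⟩, ρ σ, by rwa [hl], fun z hz => ?_⟩
    · intro x hx
      obtain ⟨y, hy, rfl⟩ := List.mem_map.1 hx
      exact (hmem y).2 (h1 y (List.mem_cons_of_mem _ hy))
    · rw [hmap, ← Ideal.map_pow, Ideal.map_le_iff_le_comap]
      exact fun x hx => (hl x).2 (hN hx)
    · obtain ⟨z, rfl⟩ := hρ z
      obtain ⟨r, hr⟩ := hs z (by rwa [← hl])
      exact ⟨ρ r, by rwa [← map_mul, ← map_sub, hl]⟩
  · rintro ⟨h0, h1, h2, ⟨N, hN⟩, σ, hσ, hs⟩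
    obtain ⟨σ, rfl⟩ := hρ σ
    refine ⟨?_, (isRegular_cons_iff_of_surjective hρ hker).2 ⟨h0, h2⟩, ⟨N, fun x hx => ?_⟩, σ,
      by rwa [← hl], fun z hz => ?_⟩
    · intro x hx
      rcases List.mem_cons.1 hx with rfl | hx
      · exact hh
      · exact (hmem x).1 (h1 _ (List.mem_map_of_mem hx))
    · refine (hl x).1 (hN ?_)
      rw [hmap, ← Ideal.map_pow]
      exact Ideal.mem_map_of_mem ρ hx
    · obtain ⟨r, hr⟩ := hs (ρ z) (by rwa [hl])
      obtain ⟨r, rfl⟩ := hρ r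
      exact ⟨r, by rwa [← hl, map_sub, map_mul]⟩

end Quotient

open PowerSeries in
theorem IsGorensteinSequence.powerSeries {B : Type*} [CommRing B] [IsLocalRing B] [IsDomain B]
    {rs : List B} (h : IsGorensteinSequence rs) :
    IsGorensteinSequence ((X : B⟦X⟧) :: rs.map C) := by
  refine (isGorensteinSequence_cons_iff (ρ := constantCoeff) constantCoeff_surj ?_).2
    ⟨?_, ?_⟩
  · ext x
    rw [RingHom.mem_ker, Ideal.mem_span_singleton, X_dvd_iff]
  · exact IsSMulRegular.of_ne_zero X_ne_zero
  · rw [List.map_map]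
    have : rs.map (constantCoeff ∘ C) = rs :=
      (List.map_congr_left fun b _ => constantCoeff_C b).trans (List.map_id _)
    rwa [this]

end GorensteinSequence

section HypersurfaceCover

open RingTheory.Sequence

open PowerSeries in
theorem prime_powerSeries_C {B : Type*} [CommRing B] [IsDomain B] {p : B} (hp : Prime p) :
    Prime (C p : B⟦X⟧) := by
  have hC : (C p : B⟦X⟧) ≠ 0 :=
    (map_ne_zero_iff C C_injective).2 hp.ne_zero
  have : (Ideal.span {p}).IsPrime := (Ideal.span_singleton_prime hp.ne_zero).2 hp
  rw [← Ideal.span_singleton_prime hC]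
  have : Ideal.span {(C p : B⟦X⟧)} = RingHom.ker (map (Ideal.Quotient.mk (Ideal.span {p}))) := by
    ext f
    rw [Ideal.mem_span_singleton, RingHom.mem_ker]
    constructor
    · rintro ⟨g, rfl⟩
      ext i
      simp
    · intro h
      have h' : ∀ i, p ∣ coeff i f := fun i => by
        have := congrArg (coeff i) h
        rwa [coeff_map, map_zero, Ideal.Quotient.eq_zero_iff_mem, Ideal.mem_span_singleton] at this
      choose g hg using h'
      exact ⟨mk g, by ext i; simp [hg]⟩
  rw [this]
  exact RingHom.ker_isPrime _

/-- `φ : B → A` is local, residually surjective, and kills a product of primes of `B` which is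
part of a regular system of parameters generating an irreducible ideal. -/
structure IsHypersurfaceCover {B A : Type*} [CommRing B] [IsLocalRing B] [CommRing A]
    [IsLocalRing A] (φ : B →+* A) (L rs : List B) : Prop where
  map_mem : ∀ b ∈ maximalIdeal B, φ b ∈ maximalIdeal A
  residue : ∀ a, ∃ b, a - φ b ∈ maximalIdeal A
  prime : ∀ p ∈ L, Prime p
  map_prod : φ L.prod = 0
  seq : IsGorensteinSequence (L.prod :: rs)

open PowerSeries in
theorem exists_isHypersurfaceCover_finite {A : Type} [CommRing A] [IsLocalRing A]
    [IsNoetherianRing A] [IsAdicComplete (maximalIdeal A) A] (xs : List A)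
    (hxs : ∀ x ∈ xs, x ∈ maximalIdeal A) :
    ∀ (B : Type) [CommRing B] [IsLocalRing B] [IsNoetherianRing B] [IsDomain B] (φ : B →+* A)
      (L rs : List B), IsHypersurfaceCover φ L rs → FiniteModulo φ (Ideal.ofList xs) →
    ∃ (P : Type) (_ : CommRing P) (_ : IsLocalRing P) (_ : IsNoetherianRing P) (_ : IsDomain P)
      (ψ : P →+* A) (L' rs' : List P), IsHypersurfaceCover ψ L' rs' ∧ ψ.Finite ∧
      rs'.length = rs.length + xs.length := by
  induction xs with
  | nil =>
    intro B _ _ _ _ φ L rs h hf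
    rw [Ideal.ofList_nil] at hf
    exact ⟨B, _, _, ‹_›, ‹_›, φ, L, rs, h, hf.finite, rfl⟩
  | cons x xs ih =>
    intro B _ _ _ _ φ L rs h hf
    have hx := hxs x List.mem_cons_self
    obtain ⟨Φ, hC, hX⟩ := exists_powerSeries_lift (maximalIdeal A) φ hx
    have hΦ : Φ.comp C = φ := RingHom.ext hC
    have hcov : IsHypersurfaceCover Φ (L.map C) (X :: rs.map C) := by
      have hp : (L.map C).prod = (C L.prod : B⟦X⟧) := (map_list_prod C L).symm
      refine ⟨fun b hb => ?_, fun a => ?_, fun p hp => ?_, ?_, ?_⟩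
      · rw [eq_X_mul_shift_add_const b, map_add, map_mul, hX]
        refine add_mem (Ideal.mul_mem_right _ _ hx) ?_
        rw [hC]
        refine h.map_mem _ ?_
        rw [mem_maximalIdeal, mem_nonunits_iff] at hb ⊢
        rwa [isUnit_iff_constantCoeff] at hb
      · obtain ⟨b, hb⟩ := h.residue a
        exact ⟨C b, by rwa [hC]⟩
      · obtain ⟨q, hq, rfl⟩ := List.mem_map.1 hp
        exact prime_powerSeries_C (h.prime q hq)
      · rw [hp, hC, h.map_prod]
      · rw [hp]
        exact h.seq.powerSeries.perm (List.Perm.swap _ _ _)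
    have hfin : FiniteModulo Φ (Ideal.ofList xs) := by
      refine FiniteModulo.powerSeries (hX ▸ hx) ?_
      rwa [hΦ, hX, ← Ideal.ofList_cons]
    obtain ⟨P, i1, i2, i3, i4, ψ, L', rs', h1, h2, h3⟩ :=
      ih (fun y hy => hxs y (List.mem_cons_of_mem _ hy)) B⟦X⟧ Φ (L.map C) (X :: rs.map C) hcov hfin
    exact ⟨P, i1, i2, i3, i4, ψ, L', rs', h1, h2, by simp [h3, add_assoc, add_comm 1]⟩

end HypersurfaceCover

section SystemOfParameters

open RingTheory.Sequence

theorem exists_pow_mul_eq_zero_of_mem_minimalPrimes {A : Type*} [CommRing A] {q : Ideal A}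
    (hq : q ∈ minimalPrimes A) {y : A} (hy : y ∈ q) : ∃ a, ∃ s ∉ q, y ^ a * s = 0 := by
  have hqp : q.IsPrime := hq.1.1
  by_contra! hcon
  have hdis : Disjoint ((⊥ : Ideal A) : Set A) (Submonoid.powers y ⊔ q.primeCompl : Submonoid A) := by
    rw [Set.disjoint_left]
    rintro x (rfl : x = 0) hx
    obtain ⟨_, ⟨a, rfl⟩, s, hs, h⟩ := Submonoid.mem_sup.1 hx
    exact hcon a s hs h
  obtain ⟨p, hp, -, hd⟩ := Ideal.exists_le_prime_disjoint _ _ hdis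
  rw [Set.disjoint_left] at hd
  have hpq : p ≤ q := fun x hx => by
    by_contra h
    exact hd hx (Submonoid.mem_sup_right (S := Submonoid.powers y) h)
  exact hd (hq.2 ⟨hp, bot_le⟩ hpq hy)
    (Submonoid.mem_sup_left (T := q.primeCompl) (Submonoid.mem_powers y))

theorem le_of_add_one_le_natCast {x : WithBot ℕ∞} {e : ℕ} (h : x + 1 ≤ ((e + 1 : ℕ) : WithBot ℕ∞)) :
    x ≤ e := by
  push_cast at h
  exact ENat.WithBot.add_le_add_one_right_iff.1 h

theorem exists_pow_mul_eq_zero_and_ringKrullDim_le {A : Type*} [CommRing A] [IsLocalRing A]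
    [IsNoetherianRing A] {e : ℕ} (hd : ringKrullDim A ≤ (e + 1 : ℕ)) (y : A) :
    ∃ t ∈ maximalIdeal A, ∃ a, y ^ a * t = 0 ∧
      ringKrullDim (A ⧸ (Ideal.span {y} ⊔ Ideal.span {t})) ≤ e := by
  classical
  let I : Ideal A :=
    { carrier := {t | ∃ a, y ^ a * t = 0}
      zero_mem' := ⟨0, mul_zero _⟩
      add_mem' := by
        rintro s t ⟨a, ha⟩ ⟨b, hb⟩
        refine ⟨a + b, ?_⟩
        linear_combination y ^ b * ha + y ^ a * hb
      smul_mem' := by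
        rintro c t ⟨a, ha⟩
        refine ⟨a, ?_⟩
        rw [smul_eq_mul]
        linear_combination c * ha }
  have hfin := (Ideal.span {y}).finite_minimalPrimes_of_isNoetherianRing A
  let Q := hfin.toFinset.filter fun q => ¬ ringKrullDim (A ⧸ q) ≤ e
  have hQ : ∀ q ∈ Q, q ∈ (Ideal.span {y}).minimalPrimes ∧ ¬ ringKrullDim (A ⧸ q) ≤ e := by
    intro q hq
    simpa [Q] using hq
  have hnot : ¬ ((I ⊓ maximalIdeal A : Ideal A) : Set A) ⊆ ⋃ q ∈ (Q : Set (Ideal A)), q := by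
    intro hsub
    obtain ⟨q, hq, hle⟩ := (Ideal.subset_union_prime (f := fun q => q) ⊥ ⊥
      fun q hq _ _ => (hQ q hq).1.1.1).1 hsub
    obtain ⟨hmin, hdim⟩ := hQ q hq
    have hqp := hmin.1.1
    rcases (Ideal.IsPrime.inf_le hqp).1 hle with h | h
    · have hqmin : q ∈ minimalPrimes A := by
        refine ⟨⟨hqp, bot_le⟩, fun p hp hpq => ?_⟩
        by_contra hlt
        have h1 := ringKrullDim_quotient_succ_le_of_lt hp.1 (lt_of_le_not_ge hpq hlt)
        exact hdim (le_of_add_one_le_natCast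
          (h1.trans ((ringKrullDim_quotient_le p).trans hd)))
      obtain ⟨a, s, hs, h0⟩ := exists_pow_mul_eq_zero_of_mem_minimalPrimes hqmin
        (hmin.1.2 (Ideal.mem_span_singleton_self y))
      exact hs (h ⟨a, h0⟩)
    · have : q = maximalIdeal A := le_antisymm (le_maximalIdeal hqp.ne_top) h
      refine hdim ?_
      rw [this]
      let _ := Ideal.Quotient.field (maximalIdeal A)
      rw [ringKrullDim_eq_zero_of_field]
      exact_mod_cast Nat.zero_le e
  obtain ⟨t, ⟨⟨a, ha⟩, htm⟩, ht⟩ := Set.not_subset.1 hnot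
  refine ⟨t, htm, a, ha, ringKrullDim_quotient_le_of_forall_prime fun p hp hle => ?_⟩
  rw [sup_le_iff] at hle
  obtain ⟨q, hq, hqp⟩ := Ideal.exists_minimalPrimes_le hle.1
  by_cases hqQ : q ∈ Q
  · have htq : t ∉ q := fun h => ht (Set.mem_biUnion (Finset.mem_coe.2 hqQ) h)
    have hlt : q < p := lt_of_le_of_ne hqp fun h =>
      htq (h ▸ hle.2 (Ideal.mem_span_singleton_self t))
    exact le_of_add_one_le_natCast ((ringKrullDim_quotient_succ_le_of_lt hq.1.1 hlt).trans
      ((ringKrullDim_quotient_le q).trans hd))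
  · refine (ringKrullDim_quotient_le_of_le hqp).trans ?_
    by_contra h
    exact hqQ (by simpa [Q, hq] using h)

theorem isGorensteinSequence_singleton {V : Type*} [CommRing V] [IsDomain V]
    [IsDiscreteValuationRing V] {x : V} (hx : x ∈ maximalIdeal V) (hx0 : x ≠ 0) :
    IsGorensteinSequence [x] := by
  obtain ⟨π, hπ⟩ := IsDiscreteValuationRing.exists_irreducible V
  obtain ⟨n, u, rfl⟩ := IsDiscreteValuationRing.eq_unit_mul_pow_irreducible hx0 hπ
  have hspan : Ideal.ofList [(u : V) * π ^ n] = Ideal.span {π ^ n} := by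
    rw [Ideal.ofList_singleton, Ideal.span_singleton_mul_left_unit u.isUnit]
  obtain _ | n := n
  · simp at hx
  refine ⟨by simpa using hx, ?_, ⟨n + 1, ?_⟩, π ^ n, ?_, fun z hz => ?_⟩
  · have hw : IsWeaklyRegular V [(u : V) * π ^ (n + 1)] :=
      (isWeaklyRegular_singleton_iff V _).2 (IsSMulRegular.of_ne_zero hx0)
    refine ⟨hw, fun h => ?_⟩
    have h1 : Ideal.ofList [(u : V) * π ^ (n + 1)] ≤ maximalIdeal V := by
      rw [Ideal.ofList_singleton, Ideal.span_singleton_le_iff_mem]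
      exact hx
    rw [smul_eq_mul, Ideal.mul_top] at h
    exact (maximalIdeal.isMaximal V).ne_top (top_le_iff.1 (h ▸ h1))
  · rw [hspan, hπ.maximalIdeal_eq, Ideal.span_singleton_pow]
  · rw [hspan, Ideal.mem_span_singleton, pow_dvd_pow_iff hπ.ne_zero hπ.not_isUnit]
    lia
  · rw [hspan] at hz ⊢
    have hz0 : z ≠ 0 := fun h => hz (h ▸ zero_mem _)
    obtain ⟨j, w, rfl⟩ := IsDiscreteValuationRing.eq_unit_mul_pow_irreducible hz0 hπ
    have hj : j ≤ n := by
      by_contra! hj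
      exact hz (Ideal.mem_span_singleton.2 (Dvd.dvd.mul_left (pow_dvd_pow π hj) _))
    refine ⟨↑w⁻¹ * π ^ (n - j), ?_⟩
    have : (↑w⁻¹ * π ^ (n - j)) * ((w : V) * π ^ j) - π ^ n = 0 := by
      rw [mul_mul_mul_comm, Units.inv_mul, one_mul, ← pow_add, Nat.sub_add_cancel hj, sub_self]
    rw [this]
    exact zero_mem _

open PowerSeries in
/-- The hypersurface `X π ^ a = 0` over a complete discrete valuation ring. -/
theorem isGorensteinSequence_X_mul {V : Type*} [CommRing V] [IsDomain V]
    [IsDiscreteValuationRing V] [IsAdicComplete (maximalIdeal V) V] {π : V} (hπ : Irreducible π)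
    (a : ℕ) : IsGorensteinSequence [(X : V⟦X⟧) * C π ^ a, C π + X] := by
  have hπm : π ∈ maximalIdeal V := by
    rw [hπ.maximalIdeal_eq]
    exact Ideal.mem_span_singleton_self π
  obtain ⟨ρ, hC, hX⟩ := exists_powerSeries_lift (maximalIdeal V) (RingHom.id V) (neg_mem hπm)
  simp only [RingHom.id_apply] at hC
  have hker : RingHom.ker ρ = Ideal.span {(C π + X : V⟦X⟧)} := by
    refine le_antisymm ?_ ?_
    · refine Submodule.le_of_le_smul_of_le_jacobson_bot (I := maximalIdeal V⟦X⟧)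
        (IsNoetherian.noetherian _) (maximalIdeal_le_jacobson _) fun f hf => ?_
      rw [RingHom.mem_ker] at hf
      obtain ⟨g, c, rfl⟩ : ∃ g c, f = X * g + C c := ⟨_, _, eq_X_mul_shift_add_const f⟩
      rw [map_add, map_mul, hC, hX] at hf
      have hc : c = π * ρ g := by linear_combination hf
      have : X * g + C c = g * (C π + X) + (-C π) * (g - C (ρ g)) := by
        rw [hc, map_mul]
        ring
      rw [this]
      refine Submodule.add_mem_sup (Ideal.mul_mem_left _ _ (Ideal.mem_span_singleton_self _))
        (Submodule.smul_mem_smul (neg_mem ?_) ?_)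
      · rw [mem_maximalIdeal, mem_nonunits_iff, isUnit_iff_constantCoeff, constantCoeff_C]
        exact hπ.not_isUnit
      · rw [RingHom.mem_ker, map_sub, hC, sub_self]
    · rw [Ideal.span_singleton_le_iff_mem, RingHom.mem_ker, map_add, hC, hX, add_neg_cancel]
  refine IsGorensteinSequence.perm (rs := [C π + X, X * C π ^ a]) ?_ (List.Perm.swap _ _ _)
  refine (isGorensteinSequence_cons_iff (ρ := ρ) (fun v => ⟨C v, hC v⟩) hker).2 ⟨?_, ?_⟩
  · refine IsSMulRegular.of_ne_zero fun h => hπ.ne_zero ?_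
    simpa using congrArg constantCoeff h
  · have : [X * C π ^ a].map ρ = [-π * π ^ a] := by simp [hC, hX]
    rw [this]
    exact isGorensteinSequence_singleton (Ideal.mul_mem_right _ _ (neg_mem hπm))
      (mul_ne_zero (neg_ne_zero.2 hπ.ne_zero) (pow_ne_zero _ hπ.ne_zero))

end SystemOfParameters

section CompleteCover

open RingTheory.Sequence

theorem FiniteModulo.of_comp {C B A : Type*} [CommRing C] [CommRing B] [CommRing A] {φ : B →+* A}
    {θ : C →+* B} {K : Ideal A} (h : FiniteModulo (φ.comp θ) K) : FiniteModulo φ K := by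
  obtain ⟨n, s, hs⟩ := h
  exact ⟨n, s, fun y => (hs y).elim fun b hb => ⟨θ ∘ b, hb⟩⟩

theorem FiniteModulo.of_uniformizer {V A : Type*} [CommRing V] [IsDomain V]
    [IsDiscreteValuationRing V] [IsAdicComplete (maximalIdeal V) V] [CommRing A] [IsLocalRing A]
    [IsNoetherianRing A] [IsAdicComplete (maximalIdeal A) A] {φ : V →+* A} {π : V}
    (hπ : π ∈ maximalIdeal V) (hφ : φ π ∈ maximalIdeal A) {K : Ideal A}
    (h : FiniteModulo φ (Ideal.span {φ π} ⊔ K)) : FiniteModulo φ K := by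
  obtain ⟨Ψ, hC, hX⟩ := exists_powerSeries_lift (maximalIdeal A) φ hφ
  obtain ⟨θ, hθC, hθX⟩ := exists_powerSeries_lift (maximalIdeal V) (RingHom.id V) hπ
  have h1 : FiniteModulo Ψ K := by
    refine FiniteModulo.powerSeries (hX ▸ hφ) ?_
    rwa [RingHom.ext (f := Ψ.comp PowerSeries.C) (g := φ) hC, hX]
  have h2 : Ψ = φ.comp θ :=
    powerSeries_ringHom_ext (maximalIdeal A) (fun b => by simp [hC, hθC]) (by simp [hX, hθX])
      (hX ▸ hφ)
  exact (h2 ▸ h1).of_comp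

open PowerSeries in
theorem exists_isHypersurfaceCover {A : Type} [CommRing A] [IsLocalRing A]
    [IsNoetherianRing A] [IsAdicComplete (maximalIdeal A) A] {d : ℕ} (hd : ringKrullDim A ≤ d) :
    ∃ (P : Type) (_ : CommRing P) (_ : IsLocalRing P) (_ : IsNoetherianRing P) (_ : IsDomain P)
      (ψ : P →+* A) (L rs : List P), IsHypersurfaceCover ψ L rs ∧ ψ.Finite ∧ rs.length = d := by
  obtain ⟨V, _, _, _, φ, _, hm, hres⟩ := exists_coefficient_dvr (A := A)
  obtain ⟨π, hπ⟩ := IsDiscreteValuationRing.exists_irreducible V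
  have hπm : π ∈ maximalIdeal V := by
    rw [hπ.maximalIdeal_eq]
    exact Ideal.mem_span_singleton_self π
  have hφπ := hm π hπm
  have hfin := finiteModulo_pow (IsNoetherian.noetherian (maximalIdeal A)) hres
  obtain _ | e := d
  · obtain ⟨xs, hlen, -, N, hN⟩ := exists_list_maximalIdeal_pow_le hd
    obtain rfl := List.length_eq_zero_iff.1 hlen
    rw [Ideal.ofList_nil] at hN
    have hprod : (List.replicate (N + 1) π).prod = π ^ (N + 1) := List.prod_replicate _ _
    refine ⟨V, _, inferInstance, inferInstance, inferInstance, φ, List.replicate (N + 1) π, [],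
      ⟨hm, hres, fun p hp => ?_, ?_, ?_⟩, ((hfin N).mono hN).finite, rfl⟩
    · rw [List.eq_of_mem_replicate hp]
      exact hπ.prime
    · rw [hprod, map_pow, pow_succ]
      have : φ π ^ N = 0 := hN (Ideal.pow_mem_pow hφπ N)
      rw [this, zero_mul]
    · rw [hprod]
      exact isGorensteinSequence_singleton (Ideal.pow_mem_of_mem _ hπm _ N.succ_pos)
        (pow_ne_zero _ hπ.ne_zero)
  · obtain ⟨t, ht, a, ha, hdim⟩ := exists_pow_mul_eq_zero_and_ringKrullDim_le hd (φ π)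
    set K := Ideal.span {φ π} ⊔ Ideal.span {t} with hK
    have hKm : K ≤ maximalIdeal A := by
      simp [hK, hφπ, ht]
    have : Nontrivial (A ⧸ K) :=
      Ideal.Quotient.nontrivial_iff.2 fun h => (maximalIdeal.isMaximal A).ne_top
        (top_le_iff.1 (h ▸ hKm))
    have : IsLocalRing (A ⧸ K) := .of_surjective' _ Ideal.Quotient.mk_surjective
    obtain ⟨ys, hlen, hys, N, hN⟩ := exists_list_maximalIdeal_pow_le hdim
    obtain ⟨xs, rfl⟩ := List.map_surjective_iff.2 (Ideal.Quotient.mk_surjective (I := K)) ys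
    have hmem := map_mem_maximalIdeal_iff_of_surjective (Ideal.Quotient.mk_surjective (I := K))
    have hxs : ∀ x ∈ xs, x ∈ maximalIdeal A := fun x hx =>
      (hmem x).1 (hys _ (List.mem_map_of_mem hx))
    have hN' : maximalIdeal A ^ N ≤ Ideal.span {φ π} ⊔ (Ideal.span {t} ⊔ Ideal.ofList xs) := by
      intro z hz
      have h1 : Ideal.Quotient.mk K z ∈ Ideal.ofList (xs.map (Ideal.Quotient.mk K)) := by
        refine hN ?_
        rw [maximalIdeal_eq_map_of_surjective (Ideal.Quotient.mk_surjective (I := K)),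
          ← Ideal.map_pow]
        exact Ideal.mem_map_of_mem _ hz
      rw [← Ideal.map_ofList, Ideal.mem_quotient_iff_mem_sup] at h1
      rwa [← sup_assoc, ← hK, sup_comm]
    obtain ⟨Φ, hC, hX⟩ := exists_powerSeries_lift (maximalIdeal A) φ ht
    have hΦ : Φ.comp C = φ := RingHom.ext hC
    have hprod : ((X : V⟦X⟧) :: List.replicate a (C π)).prod = X * C π ^ a := by
      rw [List.prod_cons, List.prod_replicate]
    have hcov : IsHypersurfaceCover Φ ((X : V⟦X⟧) :: List.replicate a (C π)) [C π + X] := by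
      refine ⟨fun b hb => ?_, fun a => ?_, fun p hp => ?_, ?_, ?_⟩
      · rw [eq_X_mul_shift_add_const b, map_add, map_mul, hX, hC]
        refine add_mem (Ideal.mul_mem_right _ _ ht) (hm _ ?_)
        rw [mem_maximalIdeal, mem_nonunits_iff] at hb ⊢
        rwa [isUnit_iff_constantCoeff] at hb
      · obtain ⟨b, hb⟩ := hres a
        exact ⟨C b, by rwa [hC]⟩
      · rcases List.mem_cons.1 hp with rfl | hp
        · exact X_prime
        · rw [List.eq_of_mem_replicate hp]
          exact prime_powerSeries_C hπ.prime
      · rw [hprod, map_mul, map_pow, hX, hC, mul_comm, ha]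
      · rw [hprod]
        exact isGorensteinSequence_X_mul hπ a
    have hfin' : FiniteModulo Φ (Ideal.ofList xs) := by
      refine FiniteModulo.powerSeries (hX ▸ ht) ?_
      rw [hΦ, hX]
      exact ((hfin N).mono hN').of_uniformizer hπm hφπ
    obtain ⟨P, i1, i2, i3, i4, ψ, L', rs', h1, h2, h3⟩ :=
      exists_isHypersurfaceCover_finite xs hxs V⟦X⟧ Φ _ _ hcov hfin'
    exact ⟨P, i1, i2, i3, i4, ψ, L', rs', h1, h2, by simpa [← hlen, add_comm] using h3⟩

end CompleteCover

section EmbeddingOverDomain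

open DirectSum in
theorem exists_injective_pi_quotient_of_isPrincipalIdealRing {R : Type*} [CommRing R] [IsDomain R]
    [IsPrincipalIdealRing R] {T : Type*} [AddCommGroup T] [Module R T] [Module.Finite R T] {h : R}
    (h0 : h ≠ 0) (hT : ∀ x : T, h • x = 0) :
    ∃ (n : ℕ) (f : T →ₗ[R] (Fin n → R ⧸ Ideal.span {h})), Function.Injective f := by
  classical
  obtain ⟨ι, _, p, hp, e, ⟨E⟩⟩ := Module.equiv_directSum_of_isTorsion (R := R) (M := T)
    fun x => ⟨⟨h, mem_nonZeroDivisors_of_ne_zero h0⟩, hT x⟩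
  have hdvd : ∀ i, ∃ c, h = p i ^ e i * c := fun i => by
    have h1 := congrArg (fun z => z i)
      (E.map_smul h (E.symm (DirectSum.lof R ι _ i (Submodule.Quotient.mk 1))))
    rw [hT, map_zero, E.apply_symm_apply] at h1
    rw [DirectSum.smul_apply, DirectSum.lof_apply, DirectSum.zero_apply,
      ← Submodule.Quotient.mk_smul, smul_eq_mul, mul_one] at h1
    exact Ideal.mem_span_singleton.1 ((Submodule.Quotient.mk_eq_zero _).1 h1.symm)
  choose c hc using hdvd
  have hmap : ∀ i, R ∙ p i ^ e i ≤ Submodule.comap (LinearMap.mulLeft R (c i)) (Ideal.span {h}) := fun i => by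
    rw [Submodule.span_singleton_le_iff_mem]
    change c i * p i ^ e i ∈ Ideal.span {h}
    rw [mul_comm, ← hc]
    exact Ideal.mem_span_singleton_self h
  let g : ∀ i, (R ⧸ R ∙ p i ^ e i) →ₗ[R] R ⧸ Ideal.span {h} := fun i =>
    Submodule.mapQ _ _ (LinearMap.mulLeft R (c i)) (hmap i)
  have hg : ∀ i, Function.Injective (g i) := fun i => by
    rw [injective_iff_map_eq_zero]
    intro x hx
    obtain ⟨x, rfl⟩ := Submodule.Quotient.mk_surjective _ x
    have h1 : c i * x ∈ Ideal.span {h} := (Submodule.Quotient.mk_eq_zero _).1 hx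
    obtain ⟨y, hy⟩ := Ideal.mem_span_singleton.1 h1
    have hc0 : c i ≠ 0 := fun hz => h0 (by rw [hc i, hz, mul_zero])
    refine (Submodule.Quotient.mk_eq_zero _).2 (Ideal.mem_span_singleton.2 ⟨y, ?_⟩)
    refine mul_left_cancel₀ hc0 ?_
    rw [hy]
    nth_rewrite 1 [hc i]
    ring
  let F : T →ₗ[R] (Fin (Fintype.card ι) → R ⧸ Ideal.span {h}) :=
    LinearMap.pi fun j => g ((Fintype.equivFin ι).symm j) ∘ₗ
      DirectSum.component R ι _ ((Fintype.equivFin ι).symm j) ∘ₗ E.toLinearMap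
  refine ⟨_, F, ?_⟩
  rw [injective_iff_map_eq_zero]
  intro x hx
  rw [← E.map_eq_zero_iff]
  ext1 i
  obtain ⟨j, rfl⟩ := (Fintype.equivFin ι).symm.surjective i
  exact hg _ ((congrFun hx j).trans (map_zero _).symm)

section

variable {P : Type*} [CommRing P]

/-- The elements not divisible by any of the primes in `L`. -/
def notDvdSubmonoid (L : List P) (hL : ∀ p ∈ L, Prime p) : Submonoid P where
  carrier := {x | ∀ p ∈ L, ¬ p ∣ x}
  one_mem' p hp h := (hL p hp).not_isUnit (isUnit_of_dvd_one h)
  mul_mem' hx hy p hp h := ((hL p hp).dvd_or_dvd h).elim (hx p hp) (hy p hp)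

variable {L : List P} {hL : ∀ p ∈ L, Prime p}

theorem notDvdSubmonoid_le_nonZeroDivisors [IsDomain P] (h0 : L ≠ []) :
    notDvdSubmonoid L hL ≤ nonZeroDivisors P := by
  obtain ⟨p, hp⟩ := List.exists_mem_of_ne_nil L h0
  exact fun x hx => mem_nonZeroDivisors_of_ne_zero fun h => hx p hp (h ▸ dvd_zero p)

theorem isPrincipalIdealRing_of_isLocalization_notDvdSubmonoid [IsDomain P] [IsNoetherianRing P]
    (R : Type*) [CommRing R] [Algebra P R] [IsLocalization (notDvdSubmonoid L hL) R] :
    IsPrincipalIdealRing R := by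
  classical
  refine IsPrincipalIdealRing.of_prime fun Q hQ => ?_
  set q := Q.comap (algebraMap P R) with hqdef
  have hqd : q.IsPrime ∧ Disjoint (notDvdSubmonoid L hL : Set P) q :=
    (IsLocalization.isPrime_iff_isPrime_disjoint (notDvdSubmonoid L hL) R Q).1 hQ
  obtain ⟨hq, hdis⟩ := hqd
  have hsub : (q : Set P) ⊆ ⋃ p ∈ (L.toFinset : Set P), (Ideal.span {p} : Ideal P) := by
    intro x hx
    by_contra hcon
    have : x ∈ notDvdSubmonoid L hL := fun p hp hpx =>
      hcon (Set.mem_biUnion (by simpa using hp) (Ideal.mem_span_singleton.2 hpx))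
    exact Set.disjoint_left.1 hdis this hx
  obtain ⟨p, hpL, hle⟩ := (Ideal.subset_union_prime (f := fun p => Ideal.span {p}) 0 0
    fun p hp _ _ => by
      have := hL p (by simpa using hp)
      exact (Ideal.span_singleton_prime this.ne_zero).2 this).1 hsub
  have hp := hL p (by simpa using hpL)
  have hQmap : Q = q.map (algebraMap P R) :=
    (IsLocalization.map_under (notDvdSubmonoid L hL) R Q).symm
  by_cases hbot : q = ⊥
  · rw [hQmap, hbot, Ideal.map_bot]
    infer_instance
  obtain ⟨x, hx, hx0⟩ := Submodule.exists_mem_ne_zero_of_ne_bot hbot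
  obtain ⟨n, y, hy, hxy⟩ := WfDvdMonoid.max_power_factor hx0 hp.irreducible
  have hpq : p ∈ q := by
    rw [hxy] at hx
    exact (hq.mem_or_mem hx).elim (fun h => hq.mem_of_pow_mem n h)
      fun h => absurd (Ideal.mem_span_singleton.1 (hle h)) hy
  have : q = Ideal.span {p} := le_antisymm hle ((Ideal.span_singleton_le_iff_mem q).2 hpq)
  rw [hQmap, this, Ideal.map_span, Set.image_singleton]
  exact ⟨_, rfl⟩

/-- A finitely generated module killed by a product `h` of primes of a Noetherian domain, all of
whose associated primes are generated by one of those primes, embeds in a free module over the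
quotient by `h`. -/
theorem exists_injective_pi_quotient {P : Type} [CommRing P] [IsDomain P] [IsNoetherianRing P]
    {L : List P} (hL : ∀ p ∈ L, Prime p) (h0 : L ≠ []) {N : Type} [AddCommGroup N] [Module P N]
    [Module.Finite P N] (hN : ∀ x : N, L.prod • x = 0)
    (hass : ∀ q : Ideal P, IsAssociatedPrime q N → ∃ p ∈ L, q = Ideal.span {p}) :
    ∃ (n : ℕ) (f : N →ₗ[P] (Fin n → P ⧸ Ideal.span {L.prod})), Function.Injective f := by
  let W := notDvdSubmonoid L hL
  let R := Localization W
  let T := LocalizedModule W N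
  have hle : W ≤ nonZeroDivisors P := notDvdSubmonoid_le_nonZeroDivisors h0
  have : IsDomain R := IsLocalization.isDomain_of_le_nonZeroDivisors (M := W) R hle
  have : IsPrincipalIdealRing R := isPrincipalIdealRing_of_isLocalization_notDvdSubmonoid (hL := hL) R
  have : Module.Finite R T :=
    Module.Finite.of_isLocalizedModule W (LocalizedModule.mkLinearMap W N)
  set h := L.prod
  have hh : h ≠ 0 := fun hz => by
    exact (hL 0 (List.prod_eq_zero_iff.1 hz)).ne_zero rfl
  have hinj : Function.Injective (algebraMap P R) := IsLocalization.injective R hle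
  have hT : ∀ x : T, algebraMap P R h • x = 0 := fun x => by
    rw [algebraMap_smul]
    induction x using LocalizedModule.induction_on with
    | h m s => rw [LocalizedModule.smul'_mk, hN, LocalizedModule.zero_mk]
  have hI : (Ideal.span {h}).localized' R W (Algebra.linearMap P R) =
      Ideal.span {algebraMap P R h} := by
    rw [Ideal.span, Submodule.localized'_span]
    simp [Ideal.span]
  obtain ⟨n, f, hf⟩ : ∃ (n : ℕ) (f : T →ₗ[R]
      (Fin n → R ⧸ (Ideal.span {h}).localized' R W (Algebra.linearMap P R))),
      Function.Injective f := by
    rw [hI]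
    exact exists_injective_pi_quotient_of_isPrincipalIdealRing (by simpa using hinj.ne hh) hT
  have := Module.finitePresentation_of_finite P N
  let κ := (Ideal.span {h}).toLocalizedQuotient' R W (Algebra.linearMap P R)
  let F : N →ₗ[P] (Fin n → R ⧸ (Ideal.span {h}).localized' R W (Algebra.linearMap P R)) :=
    f.restrictScalars P ∘ₗ LocalizedModule.mkLinearMap W N
  obtain ⟨G, s, hG⟩ := Module.FinitePresentation.exists_lift_of_isLocalizedModule W
    (LinearMap.pi fun i : Fin n => κ ∘ₗ LinearMap.proj i) F
  refine ⟨n, G, ?_⟩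
  rw [injective_iff_map_eq_zero]
  intro x hx
  have h1 : F ((s : P) • x) = 0 := by
    have := LinearMap.congr_fun hG x
    rw [LinearMap.comp_apply, hx, map_zero] at this
    rw [map_smul]
    exact this.symm
  have h2 : LocalizedModule.mkLinearMap W N ((s : P) • x) = 0 :=
    hf (h1.trans (map_zero f).symm)
  obtain ⟨t, ht⟩ := (IsLocalizedModule.eq_zero_iff W (LocalizedModule.mkLinearMap W N)).1 h2
  by_contra hx0
  obtain ⟨q, hq, hqx⟩ := exists_le_isAssociatedPrime_of_isNoetherianRing P x hx0
  obtain ⟨p, hp, rfl⟩ := hass q hq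
  have hmem : ((t * s : W) : P) ∈ Ideal.span {p} := hqx (by
    rw [Submodule.mem_colon_singleton, Submodule.mem_bot]
    rw [Submonoid.smul_def] at ht
    rw [Submonoid.coe_mul, mul_smul, ht])
  exact (t * s).2 p hp (Ideal.mem_span_singleton.1 hmem)

end

end EmbeddingOverDomain

section AssociatedPrimes

open RingTheory.Sequence

theorem exists_isAssociatedPrime_comap_eq {P A N : Type*} [CommRing P] [IsNoetherianRing P]
    [CommRing A] [IsNoetherianRing A] [Algebra P A] [AddCommGroup N] [Module P N] [Module A N]
    [IsScalarTower P A N] {q : Ideal P} (hq : IsAssociatedPrime q N) :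
    ∃ q' : Ideal A, IsAssociatedPrime q' N ∧ q'.comap (algebraMap P A) = q := by
  obtain ⟨hprime, x, hx⟩ := isAssociatedPrime_iff.1 hq
  have hcol : ∀ (y : N) (p : P), algebraMap P A p ∈ (⊥ : Submodule A N).colon {y} ↔ p • y = 0 := by
    intro y p
    rw [Submodule.mem_colon_singleton, Submodule.mem_bot, algebraMap_smul]
  have hxq : ∀ p, p ∈ q ↔ p • x = 0 := by
    intro p
    rw [hx, Submodule.mem_colon_singleton, Submodule.mem_bot]
  obtain ⟨I, ⟨y, hy, hyq⟩, hmax⟩ := set_has_maximal_iff_noetherian.2 ‹IsNoetherianRing A›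
    {I : Ideal A | ∃ y : N, I = (⊥ : Submodule A N).colon {y} ∧ I.comap (algebraMap P A) = q}
    ⟨_, x, rfl, by ext p; rw [Ideal.mem_comap, hcol, hxq]⟩
  have hI : ∀ a, a ∈ I ↔ a • y = 0 := by
    intro a
    rw [hy, Submodule.mem_colon_singleton, Submodule.mem_bot]
  refine ⟨I, isAssociatedPrime_iff.2 ⟨?_, y, hy⟩, hyq⟩
  have hmem : ∀ (c : A), (∀ p, p • c • y = 0 → p ∈ q) → ∀ a, a • c • y = 0 → a ∈ I := by
    intro c hc a ha
    have hle : I ≤ (⊥ : Submodule A N).colon {c • y} := by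
      intro b hb
      rw [Submodule.mem_colon_singleton, Submodule.mem_bot, smul_comm, (hI b).1 hb, smul_zero]
    have heq : I = (⊥ : Submodule A N).colon {c • y} := by
      refine hle.eq_of_not_lt (hmax _ ⟨c • y, rfl, ?_⟩)
      ext p
      rw [Ideal.mem_comap, hcol]
      refine ⟨hc p, fun hp => ?_⟩
      rw [← hcol]
      exact hle (by rw [← Ideal.mem_comap, hyq]; exact hp)
    rw [heq, Submodule.mem_colon_singleton, Submodule.mem_bot]
    exact ha
  refine ⟨fun h => hprime.ne_top ?_, fun {a b} hab => ?_⟩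
  · rw [← hyq, h, Ideal.comap_top]
  · by_cases hb : ∀ p, p • b • y = 0 → p ∈ q
    · exact .inl (hmem b hb a (by rw [smul_smul]; exact (hI _).1 hab))
    · push Not at hb
      obtain ⟨p, hp, hpq⟩ := hb
      refine .inr (hmem (algebraMap P A p) (fun p' hp' => ?_) b ?_)
      · have : p' * p ∈ q := by
          rw [← hyq, Ideal.mem_comap, hI, algebraMap_smul, mul_smul]
          rwa [algebraMap_smul] at hp'
        exact (hprime.mem_or_mem this).resolve_right hpq
      · rw [algebraMap_smul, smul_comm]
        exact hp

theorem ringKrullDim_quotient_le_comap {P A : Type*} [CommRing P] [CommRing A] [Algebra P A]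
    [Algebra.IsIntegral P A] (q : Ideal A) :
    ringKrullDim (A ⧸ q) ≤ ringKrullDim (P ⧸ q.comap (algebraMap P A)) := by
  rw [ringKrullDim_quotient, ringKrullDim_quotient]
  refine Order.krullDim_le_of_strictMono
    (fun Q => ⟨⟨Q.1.1.comap (algebraMap P A), inferInstance⟩, ?_⟩) ?_
  · have : q ≤ Q.1.1 := Q.2
    exact fun p hp => this hp
  · intro Q Q' h
    have h' : Q.1.1 < Q'.1.1 := h
    exact Ideal.IsIntegral.comap_lt_comap h'

/-- `N` embeds, semilinearly along `χ`, into a finite free module over a Gorenstein ring `S` over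
which `A` is finite. -/
structure IsGorensteinEmbedding {S A N : Type*} [CommRing S] [IsLocalRing S] [CommRing A]
    [IsLocalRing A] [AddCommGroup N] [Module A N] (χ : S →+* A) (rs : List S) {n : ℕ}
    (g : N →+ (Fin n → S)) : Prop where
  map_mem : ∀ b ∈ maximalIdeal S, χ b ∈ maximalIdeal A
  residue : ∀ a, ∃ b, a - χ b ∈ maximalIdeal A
  finite : χ.Finite
  seq : IsGorensteinSequence rs
  injective : Function.Injective g
  map_smul : ∀ s x, g (χ s • x) = s • g x

theorem IsHypersurfaceCover.exists_isGorensteinEmbedding {P A N : Type} [CommRing P]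
    [IsLocalRing P] [IsNoetherianRing P] [IsDomain P] [CommRing A] [IsLocalRing A]
    [IsNoetherianRing A] {ψ : P →+* A} {L rs : List P}
    (h : IsHypersurfaceCover ψ L rs) (hfin : ψ.Finite) [AddCommGroup N] [Module A N]
    [Module.Finite A N]
    (hass : ∀ q : Ideal A, IsAssociatedPrime q N → ringKrullDim (A ⧸ q) = rs.length) :
    ∃ (S : Type) (_ : CommRing S) (_ : IsLocalRing S) (_ : IsNoetherianRing S) (χ : S →+* A)
      (rs' : List S) (n : ℕ) (g : N →+ (Fin n → S)), rs'.length = rs.length ∧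
      IsGorensteinEmbedding χ rs' g := by
  have hprod : L.prod ∈ maximalIdeal P := h.seq.mem _ (by simp)
  have hL0 : L ≠ [] := by
    rintro rfl
    exact (Ideal.ne_top_iff_one _).1 (Ideal.IsPrime.ne_top') hprod
  let J := Ideal.span {L.prod}
  have hJm : J ≤ maximalIdeal P := by simpa [J] using hprod
  have : Nontrivial (P ⧸ J) :=
    Ideal.Quotient.nontrivial_iff.2 fun hJ => Ideal.IsPrime.ne_top' (top_le_iff.1 (hJ ▸ hJm))
  have hloc : IsLocalRing (P ⧸ J) := .of_surjective' _ Ideal.Quotient.mk_surjective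
  let χ : P ⧸ J →+* A := Ideal.Quotient.lift J ψ fun a ha => by
    obtain ⟨c, rfl⟩ := Ideal.mem_span_singleton.1 ha
    rw [map_mul, h.map_prod, zero_mul]
  have hχ : ∀ p, χ (Ideal.Quotient.mk J p) = ψ p := fun p => rfl
  have hseq : IsGorensteinSequence (rs.map (Ideal.Quotient.mk J)) :=
    ((isGorensteinSequence_cons_iff Ideal.Quotient.mk_surjective Ideal.mk_ker).1 h.seq).2
  have hdim : ringKrullDim (P ⧸ J) = rs.length := by
    rw [hseq.ringKrullDim_eq, List.length_map]
  let := ψ.toAlgebra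
  let := Module.compHom N ψ
  have : IsScalarTower P A N := ⟨fun p a x => by
    rw [Algebra.smul_def, mul_smul]; rfl⟩
  have : Module.Finite P A := hfin
  have : Module.Finite P N := .trans A N
  have hsmul : ∀ (p : P) (x : N), p • x = ψ p • x := fun p x => rfl
  have hkill : ∀ x : N, L.prod • x = 0 := fun x => by
    rw [hsmul, h.map_prod, zero_smul]
  have hassP : ∀ q : Ideal P, IsAssociatedPrime q N → ∃ p ∈ L, q = Ideal.span {p} := by
    intro q hq
    obtain ⟨q', hq', rfl⟩ := exists_isAssociatedPrime_comap_eq (A := A) hq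
    have hqp := hq.isPrime
    have hdq : (rs.length : WithBot ℕ∞) ≤ ringKrullDim (P ⧸ q'.comap (algebraMap P A)) :=
      (hass q' hq').symm.le.trans (ringKrullDim_quotient_le_comap q')
    have hpr : L.prod ∈ q'.comap (algebraMap P A) := by
      rw [Ideal.mem_comap]
      change ψ L.prod ∈ q'
      rw [h.map_prod]
      exact zero_mem _
    obtain ⟨p, hp, hpq⟩ := (hqp.multiset_prod_mem_iff_exists_mem (L : Multiset P)).1
      (by rwa [Multiset.prod_coe])
    rw [Multiset.mem_coe] at hp
    have hpP := h.prime p hp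
    have : (Ideal.span {p}).IsPrime := (Ideal.span_singleton_prime hpP.ne_zero).2 hpP
    have hle : Ideal.span {p} ≤ q'.comap (algebraMap P A) := by
      rwa [Ideal.span_singleton_le_iff_mem]
    refine ⟨p, hp, (hle.eq_of_not_lt fun hlt => ?_).symm⟩
    have h1 := ringKrullDim_quotient_succ_le_of_lt this hlt
    have h2 : ringKrullDim (P ⧸ Ideal.span {p}) ≤ ringKrullDim (P ⧸ J) :=
      ringKrullDim_quotient_le_of_le
        (Ideal.span_singleton_le_span_singleton.2 (List.dvd_prod hp))
    rw [hdim] at h2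
    have h3 : ((rs.length : WithBot ℕ∞)) + 1 ≤ rs.length :=
      (add_le_add_left hdq 1).trans (h1.trans h2)
    have h4 : ((rs.length + 1 : ℕ) : WithBot ℕ∞) ≤ (rs.length : ℕ) := by
      rw [Nat.cast_add, Nat.cast_one]; exact h3
    have h5 : rs.length + 1 ≤ rs.length := by exact_mod_cast h4
    omega
  obtain ⟨n, f, hf⟩ := exists_injective_pi_quotient h.prime hL0 hkill hassP
  refine ⟨P ⧸ J, inferInstance, hloc, inferInstance, χ, rs.map (Ideal.Quotient.mk J), n,
    f.toAddMonoidHom, List.length_map _, ?_, ?_, ?_, hseq, hf, ?_⟩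
  · intro b hb
    obtain ⟨b, rfl⟩ := Ideal.Quotient.mk_surjective b
    rw [hχ]
    exact h.map_mem _ ((map_mem_maximalIdeal_iff_of_surjective Ideal.Quotient.mk_surjective b).1 hb)
  · intro a
    obtain ⟨b, hb⟩ := h.residue a
    exact ⟨Ideal.Quotient.mk J b, hb⟩
  · have : (χ.comp (Ideal.Quotient.mk J)).Finite := hfin
    exact RingHom.Finite.of_comp_finite this
  · intro s x
    obtain ⟨s, rfl⟩ := Ideal.Quotient.mk_surjective s
    rw [hχ, ← hsmul]
    exact f.map_smul s x

end AssociatedPrimes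

section AdjoinRootGorenstein

open RingTheory.Sequence

section AdjoinRoot

open Polynomial AdjoinRoot

variable {S : Type*} [CommRing S] {f : S[X]}

theorem exists_degree_lt_and_mk_eq [Nontrivial S] (hf : f.Monic) (z : AdjoinRoot f) :
    ∃ p : S[X], p.degree < f.degree ∧ mk f p = z := by
  obtain ⟨p, rfl⟩ := mk_surjective z
  refine ⟨p %ₘ f, degree_modByMonic_lt p hf, ?_⟩
  rw [mk_eq_mk]
  exact ⟨-(p /ₘ f), by linear_combination modByMonic_add_div p f⟩

theorem mk_mem_map_of_iff (hf : f.Monic) (Q : Ideal S) {p : S[X]} (hp : p.degree < f.degree) :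
    mk f p ∈ Q.map (of f) ↔ ∀ i, p.coeff i ∈ Q := by
  have hmap : Q.map (of f) = (Q.map C).map (mk f) := by
    rw [Ideal.map_map]; rfl
  rw [← Ideal.mem_map_C_iff, hmap]
  refine ⟨fun h => ?_, Ideal.mem_map_of_mem _⟩
  obtain ⟨q, hq, hqp⟩ := (Ideal.mem_map_iff_of_surjective _ mk_surjective).1 h
  have hker : ∀ q : S[X], q ∈ Q.map C ↔ q.map (Ideal.Quotient.mk Q) = 0 := by
    intro q
    rw [Ideal.mem_map_C_iff, Polynomial.ext_iff]
    simp [Ideal.Quotient.eq_zero_iff_mem]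
  have hdvd : f.map (Ideal.Quotient.mk Q) ∣ p.map (Ideal.Quotient.mk Q) := by
    have := Polynomial.map_dvd (Ideal.Quotient.mk Q) (mk_eq_mk.1 hqp)
    rwa [Polynomial.map_sub, (hker q).1 hq, zero_sub, dvd_neg] at this
  rw [hker]
  by_contra h0
  have : Nontrivial (S ⧸ Q) := by
    by_contra hT
    rw [not_nontrivial_iff_subsingleton] at hT
    exact h0 (Subsingleton.elim _ _)
  refine (hf.map _).not_dvd_of_degree_lt h0 ?_ hdvd
  rw [hf.degree_map]
  exact degree_map_le.trans_lt hp

theorem exists_sub_of_mem (z : AdjoinRoot f) : ∃ s, z - of f s ∈ Ideal.span {root f} := by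
  obtain ⟨p, rfl⟩ := mk_surjective z
  refine ⟨p.coeff 0, Ideal.mem_span_singleton.2 ⟨mk f p.divX, ?_⟩⟩
  have := congrArg (mk f) (divX_mul_X_add p)
  rw [map_add, map_mul, mk_X, mk_C] at this
  rw [← this]
  ring

variable [IsLocalRing S]

theorem root_pow_mem (hf : f.IsDistinguishedAt (maximalIdeal S)) :
    root f ^ f.natDegree ∈ (maximalIdeal S).map (of f) := by
  have h : mk f (X ^ f.natDegree + ∑ i ∈ Finset.range f.natDegree, C (f.coeff i) * X ^ i) = 0 := by
    rw [← hf.monic.as_sum, mk_self]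
  rw [map_add, map_pow, mk_X, map_sum] at h
  rw [eq_neg_of_add_eq_zero_left h]
  refine neg_mem (sum_mem fun i hi => ?_)
  rw [map_mul, mk_C]
  exact Ideal.mul_mem_right _ _ (Ideal.mem_map_of_mem _ (hf.mem (Finset.mem_range.1 hi)))

/-- The residue map of `AdjoinRoot f`. -/
noncomputable def residueHom (hf : f.IsDistinguishedAt (maximalIdeal S)) (h0 : 0 < f.natDegree) :
    AdjoinRoot f →+* ResidueField S :=
  lift (residue S) 0 <| by
    rw [eval₂_at_zero, residue_eq_zero_iff]
    exact hf.mem h0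

theorem ker_residueHom (hf : f.IsDistinguishedAt (maximalIdeal S)) (h0 : 0 < f.natDegree) :
    RingHom.ker (residueHom hf h0) = Ideal.span {root f} ⊔ (maximalIdeal S).map (of f) := by
  have hr : root f ∈ RingHom.ker (residueHom hf h0) := by
    rw [RingHom.mem_ker, residueHom, lift_root]
  refine le_antisymm (fun z hz => ?_) (sup_le ?_ ?_)
  · obtain ⟨s, hs⟩ := exists_sub_of_mem z
    have h1 : z - of f s ∈ RingHom.ker (residueHom hf h0) :=
      (Ideal.span_singleton_le_iff_mem _).2 hr hs
    have h2 : of f s ∈ RingHom.ker (residueHom hf h0) := by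
      have := sub_mem hz h1
      rwa [sub_sub_cancel] at this
    rw [RingHom.mem_ker, residueHom, lift_of, residue_eq_zero_iff] at h2
    have := add_mem (Ideal.mem_sup_left hs) (Ideal.mem_sup_right (Ideal.mem_map_of_mem (of f) h2))
    rwa [sub_add_cancel] at this
  · rwa [Ideal.span_singleton_le_iff_mem]
  · refine Ideal.map_le_iff_le_comap.2 fun s hs => ?_
    rw [Ideal.mem_comap, RingHom.mem_ker, residueHom, lift_of, residue_eq_zero_iff]
    exact hs

theorem isMaximal_ker_residueHom (hf : f.IsDistinguishedAt (maximalIdeal S))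
    (h0 : 0 < f.natDegree) : (RingHom.ker (residueHom hf h0)).IsMaximal := by
  refine RingHom.ker_isMaximal_of_surjective _ fun k => ?_
  obtain ⟨s, rfl⟩ := residue_surjective k
  exact ⟨of f s, by rw [residueHom, lift_of]⟩

theorem eq_ker_residueHom (hf : f.IsDistinguishedAt (maximalIdeal S)) (h0 : 0 < f.natDegree)
    {I : Ideal (AdjoinRoot f)} (hI : I.IsMaximal) :
    I = RingHom.ker (residueHom hf h0) := by
  refine ((isMaximal_ker_residueHom hf h0).eq_of_le hI.ne_top ?_).symm
  have := hf.monic.finite_adjoinRoot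
  have hle : (maximalIdeal S).map (of f) ≤ I := by
    rw [Ideal.map_le_iff_le_comap]
    exact (eq_maximalIdeal
      (Ideal.isMaximal_comap_of_isIntegral_of_isMaximal (R := S) I)).ge
  rw [ker_residueHom]
  refine sup_le ?_ hle
  rw [Ideal.span_singleton_le_iff_mem]
  exact hI.isPrime.mem_of_pow_mem _ (hle (root_pow_mem hf))

theorem isLocalRing_adjoinRoot (hf : f.IsDistinguishedAt (maximalIdeal S))
    (h0 : 0 < f.natDegree) : IsLocalRing (AdjoinRoot f) :=
  .of_unique_max_ideal ⟨_, isMaximal_ker_residueHom hf h0, fun _ => eq_ker_residueHom hf h0⟩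

theorem maximalIdeal_adjoinRoot (hf : f.IsDistinguishedAt (maximalIdeal S))
    (h0 : 0 < f.natDegree) [IsLocalRing (AdjoinRoot f)] :
    maximalIdeal (AdjoinRoot f) = Ideal.span {root f} ⊔ (maximalIdeal S).map (of f) := by
  rw [eq_ker_residueHom hf h0 (maximalIdeal.isMaximal _), ker_residueHom]

theorem exists_mul_notMem_and_mem_of_pow_le {A : Type*} [CommRing A] {I Q : Ideal A} {N : ℕ}
    (hN : I ^ N ≤ Q) {z : A} (hz : z ∉ Q) : ∃ y, y * z ∉ Q ∧ ∀ u ∈ I, u * (y * z) ∈ Q := by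
  classical
  have hex : ∃ k, ∀ y ∈ I ^ k, y * z ∈ Q := ⟨N, fun y hy => Q.mul_mem_right _ (hN hy)⟩
  have hk0 : Nat.find hex ≠ 0 := by
    intro h
    have := Nat.find_spec hex
    rw [h] at this
    exact hz (by simpa using this 1 (by simp))
  obtain ⟨k, hk⟩ := Nat.exists_eq_succ_of_ne_zero hk0
  have hlt := Nat.find_min hex (m := k) (by omega)
  push Not at hlt
  obtain ⟨y, hy, hyz⟩ := hlt
  refine ⟨y, hyz, fun u hu => ?_⟩
  rw [← mul_assoc]
  refine Nat.find_spec hex _ ?_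
  rw [hk, pow_succ']
  exact Ideal.mul_mem_mul hu hy

theorem exists_mul_sub_socle_mem (hf : f.IsDistinguishedAt (maximalIdeal S))
    (h0 : 0 < f.natDegree) [IsLocalRing (AdjoinRoot f)] {Q : Ideal S} {σ : S}
    (hσ : ∀ z ∉ Q, ∃ r, r * z - σ ∈ Q) {w : AdjoinRoot f} (hw : w ∉ Q.map (of f))
    (hmw : ∀ u ∈ maximalIdeal (AdjoinRoot f), u * w ∈ Q.map (of f)) :
    ∃ r, r * w - of f σ * root f ^ (f.natDegree - 1) ∈ Q.map (of f) := by
  obtain ⟨e, he⟩ : ∃ e, f.natDegree = e + 1 := Nat.exists_eq_succ_of_ne_zero h0.ne'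
  have hfe : f.degree = ((e + 1 : ℕ) : WithBot ℕ) := by
    rw [degree_eq_natDegree hf.monic.ne_zero, he]
  obtain ⟨p, hp, rfl⟩ := exists_degree_lt_and_mk_eq hf.monic w
  rw [he, Nat.add_sub_cancel]
  have hp' : ∀ i, e + 1 ≤ i → p.coeff i = 0 := by
    rw [hfe] at hp
    exact (degree_lt_iff_coeff_zero _ _).1 hp
  have hs : ∀ s ∈ maximalIdeal S, ∀ i, s * p.coeff i ∈ Q := by
    intro s hs i
    have h1 : mk f (C s * p) ∈ Q.map (of f) := by
      rw [map_mul, mk_C]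
      refine hmw _ ?_
      rw [maximalIdeal_adjoinRoot hf h0]
      exact Ideal.mem_sup_right (Ideal.mem_map_of_mem _ hs)
    have hdeg : (C s * p).degree < f.degree := by
      rw [← smul_eq_C_mul]
      exact (degree_smul_le s p).trans_lt hp
    rw [← coeff_C_mul]
    exact (mk_mem_map_of_iff hf.monic Q hdeg).1 h1 i
  have hlow : ∀ i, i ≠ e → p.coeff i ∈ Q := by
    intro i hi
    rcases lt_or_ge e i with hlt | hle
    · rw [hp' i hlt]
      exact zero_mem _
    have hie : i + 1 < f.natDegree := by omega
    have h1 : mk f (X * p - C (p.coeff e) * f) ∈ Q.map (of f) := by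
      rw [map_sub, map_mul, map_mul, mk_self, mul_zero, sub_zero, mk_X]
      refine hmw _ ?_
      rw [maximalIdeal_adjoinRoot hf h0]
      exact Ideal.mem_sup_left (Ideal.mem_span_singleton_self _)
    have hdeg : (X * p - C (p.coeff e) * f).degree < f.degree := by
      rw [hfe, degree_lt_iff_coeff_zero]
      intro m hm
      obtain ⟨m, rfl⟩ := Nat.exists_eq_succ_of_ne_zero (n := m) (by omega)
      rw [Nat.succ_eq_add_one, coeff_sub, coeff_X_mul, coeff_C_mul]
      rcases (show e ≤ m by omega).eq_or_lt with rfl | hlt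
      · have : f.coeff (e + 1) = 1 := by rw [← he]; exact hf.monic.coeff_natDegree
        rw [this, mul_one, sub_self]
      · rw [hp' m hlt, coeff_eq_zero_of_natDegree_lt (p := f) (by omega), mul_zero, sub_zero]
    have h2 := (mk_mem_map_of_iff hf.monic Q hdeg).1 h1 (i + 1)
    rw [coeff_sub, coeff_X_mul, coeff_C_mul, mul_comm] at h2
    have := add_mem h2 (hs _ (hf.mem hie) e)
    rwa [sub_add_cancel] at this
  have htop : p.coeff e ∉ Q := fun h => hw <| (mk_mem_map_of_iff hf.monic Q hp).2 fun i => by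
    by_cases hi : i = e
    · rwa [hi]
    · exact hlow i hi
  obtain ⟨r, hr⟩ := hσ _ htop
  refine ⟨of f r, ?_⟩
  have hdeg : (C r * p - C σ * X ^ e).degree < f.degree := by
    rw [hfe, degree_lt_iff_coeff_zero]
    intro m hm
    rw [coeff_sub, coeff_C_mul, coeff_C_mul, coeff_X_pow, hp' m hm, if_neg (by omega)]
    ring
  have := (mk_mem_map_of_iff hf.monic Q hdeg).2 fun i => by
    rw [coeff_sub, coeff_C_mul, coeff_C_mul, coeff_X_pow]
    split_ifs with hi
    · rw [hi, mul_one]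
      exact hr
    · rw [mul_zero, sub_zero]
      exact Q.mul_mem_left _ (hlow i hi)
  rwa [map_sub, map_mul, map_mul, map_pow, mk_C, mk_C, mk_X] at this

theorem IsGorensteinSequence.map_of [IsNoetherianRing S]
    (hf : f.IsDistinguishedAt (maximalIdeal S)) (h0 : 0 < f.natDegree)
    [IsLocalRing (AdjoinRoot f)] {rs : List S} (h : IsGorensteinSequence rs) : IsGorensteinSequence (rs.map (of f)) := by
  have hmax := maximalIdeal_adjoinRoot hf h0
  have := hf.monic.free_adjoinRoot
  have hmap : Ideal.ofList (rs.map (of f)) = (Ideal.ofList rs).map (of f) :=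
    (Ideal.map_ofList _ _).symm
  have hpow : ∃ N, maximalIdeal (AdjoinRoot f) ^ N ≤ Ideal.ofList (rs.map (of f)) := by
    refine Ideal.exists_pow_le_of_le_radical_of_fg ?_ (IsNoetherian.noetherian _)
    have hle : (maximalIdeal S).map (of f) ≤ (Ideal.ofList (rs.map (of f))).radical := by
      obtain ⟨N, hN⟩ := h.pow_le
      refine Ideal.map_le_iff_le_comap.2 fun s hs => ⟨N, ?_⟩
      rw [hmap, ← map_pow]
      exact Ideal.mem_map_of_mem _ (hN (Ideal.pow_mem_pow hs N))
    rw [hmax]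
    refine sup_le ?_ hle
    rw [Ideal.span_singleton_le_iff_mem, ← Ideal.radical_idem]
    exact ⟨_, hle (root_pow_mem hf)⟩
  obtain ⟨σ, hσ, hs⟩ := h.socle
  refine ⟨?_, h.regular.of_faithfullyFlat, hpow, of f σ * root f ^ (f.natDegree - 1), ?_, ?_⟩
  · intro x hx
    obtain ⟨r, hr, rfl⟩ := List.mem_map.1 hx
    rw [hmax]
    exact Ideal.mem_sup_right (Ideal.mem_map_of_mem _ (h.mem r hr))
  · rw [hmap]
    intro hmem
    have heq : of f σ * root f ^ (f.natDegree - 1) =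
        AdjoinRoot.mk f (C σ * X ^ (f.natDegree - 1)) := by
      rw [map_mul, map_pow, mk_C, mk_X]
    rw [heq, mk_mem_map_of_iff hf.monic] at hmem
    · exact hσ (by simpa using hmem (f.natDegree - 1))
    · refine (degree_C_mul_X_pow_le _ _).trans_lt ?_
      rw [degree_eq_natDegree hf.monic.ne_zero]
      exact_mod_cast Nat.sub_lt h0 one_pos
  · intro z hz
    obtain ⟨N, hN⟩ := hpow
    obtain ⟨y, hy, hmy⟩ := exists_mul_notMem_and_mem_of_pow_le hN hz
    rw [hmap] at hy hmy ⊢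
    obtain ⟨r, hr⟩ := exists_mul_sub_socle_mem hf h0 hs hy hmy
    exact ⟨r * y, by rwa [mul_assoc]⟩

end AdjoinRoot

end AdjoinRootGorenstein

section AdjoinRootEmbedding

open RingTheory.Sequence

section Lift

open Polynomial

theorem exists_pow_mem_map_maximalIdeal {S A : Type*} [CommRing S] [IsLocalRing S] [CommRing A]
    [IsLocalRing A] [Algebra S A] [Algebra.IsIntegral S A] {a : A} (ha : a ∈ maximalIdeal A) :
    ∃ N, a ^ N ∈ (maximalIdeal S).map (algebraMap S A) := by
  change a ∈ ((maximalIdeal S).map (algebraMap S A)).radical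
  rw [Ideal.radical_eq_sInf, Ideal.mem_sInf]
  rintro Q ⟨hQ, hQp⟩
  have hle : maximalIdeal S ≤ Q.comap (algebraMap S A) := Ideal.map_le_iff_le_comap.1 hQ
  have heq : maximalIdeal S = Q.comap (algebraMap S A) :=
    (maximalIdeal.isMaximal S).eq_of_le (Ideal.IsPrime.ne_top inferInstance) hle
  have : Q.IsMaximal := by
    refine Ideal.isMaximal_of_isIntegral_of_isMaximal_comap (R := S) Q ?_
    rw [← heq]
    exact maximalIdeal.isMaximal S
  rwa [eq_maximalIdeal this]

theorem exists_isDistinguishedAt_eval₂_eq_zero {S A : Type*} [CommRing S] [IsLocalRing S]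
    [CommRing A] [IsLocalRing A] {χ : S →+* A} (hχ : χ.Finite) {a : A} (ha : a ∈ maximalIdeal A) :
    ∃ f : S[X], f.IsDistinguishedAt (maximalIdeal S) ∧ 0 < f.natDegree ∧ f.eval₂ χ a = 0 := by
  let := χ.toAlgebra
  have : Module.Finite S A := hχ
  obtain ⟨N, hN⟩ := exists_pow_mem_map_maximalIdeal (S := S) ha
  have hN1 : a ^ (N + 1) ∈ (maximalIdeal S).map (algebraMap S A) := by
    rw [pow_succ]
    exact Ideal.mul_mem_right _ _ hN
  obtain ⟨p, hp, -, hcoeff, hp0⟩ :=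
    LinearMap.exists_monic_and_natDegree_eq_and_coeff_mem_pow_and_aeval_eq_zero S
      (Algebra.lmul S A (a ^ (N + 1))) (maximalIdeal S) (by
        rintro _ ⟨x, rfl⟩
        rw [Ideal.smul_top_eq_map]
        exact Ideal.mul_mem_right _ _ hN1)
  have hp1 : aeval (a ^ (N + 1)) p = 0 := by
    rw [aeval_algHom_apply] at hp0
    simpa using LinearMap.congr_fun hp0 1
  have hf : (expand S (N + 1) p).Monic := hp.expand N.succ_pos
  have hf0 : (expand S (N + 1) p).eval₂ χ a = 0 := by
    rw [← hp1, ← expand_aeval]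
    rfl
  refine ⟨_, ⟨⟨fun {i} hi => ?_⟩, hf⟩, ?_, hf0⟩
  · rw [natDegree_expand] at hi
    rw [coeff_expand N.succ_pos]
    split_ifs with hd
    · obtain ⟨c, rfl⟩ := hd
      rw [Nat.mul_div_cancel_left _ N.succ_pos]
      have hc : c < p.natDegree := by
        rw [mul_comm] at hi
        exact lt_of_mul_lt_mul_right hi (Nat.zero_le _)
      exact Ideal.pow_le_self (by omega) (hcoeff c)
    · exact zero_mem _
  · rw [Nat.pos_iff_ne_zero]
    intro h
    rw [hf.natDegree_eq_zero.1 h] at hf0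
    simp at hf0

theorem coeff_divX_iterate {S : Type*} [Semiring S] (f : S[X]) (i j : ℕ) :
    (divX^[i] f).coeff j = f.coeff (j + i) := by
  induction i generalizing j with
  | zero => rfl
  | succ i ih =>
    rw [Function.iterate_succ_apply', coeff_divX, ih]
    congr 1
    omega

theorem divX_iterate_natDegree {S : Type*} [Semiring S] {f : S[X]} (hf : f.Monic) :
    divX^[f.natDegree] f = 1 := by
  ext j
  rw [coeff_divX_iterate, coeff_one]
  split_ifs with hj
  · rw [hj, zero_add, hf.coeff_natDegree]
  · exact coeff_eq_zero_of_natDegree_lt (by omega)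

variable {S A N : Type*} [CommRing S] [CommRing A] [AddCommGroup N] [Module A N] {χ : S →+* A}
  {n : ℕ} (g : N →+ (Fin n → S)) (f : S[X]) (a : A)

/-- The polynomial representing a coordinate of `adjoinRootLift`. -/
noncomputable def adjoinRootLiftPoly (x : N) (j : Fin n) : S[X] :=
  ∑ i ∈ Finset.range f.natDegree, C (g (a ^ i • x) j) * divX^[i + 1] f

theorem degree_adjoinRootLiftPoly_lt (hf : f.Monic) (h0 : 0 < f.natDegree) (x : N) (j : Fin n) :
    (adjoinRootLiftPoly g f a x j).degree < f.degree := by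
  have : Nontrivial S := by
    by_contra h
    rw [not_nontrivial_iff_subsingleton] at h
    rw [Subsingleton.elim f 0, natDegree_zero] at h0
    exact lt_irrefl _ h0
  rw [degree_eq_natDegree hf.ne_zero, degree_lt_iff_coeff_zero]
  intro m hm
  rw [adjoinRootLiftPoly, finsetSum_coeff]
  refine Finset.sum_eq_zero fun i _ => ?_
  rw [coeff_C_mul, coeff_divX_iterate, coeff_eq_zero_of_natDegree_lt (by omega), mul_zero]

theorem coeff_adjoinRootLiftPoly (hf : f.Monic) (h0 : 0 < f.natDegree) (x : N) (j : Fin n) :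
    (adjoinRootLiftPoly g f a x j).coeff (f.natDegree - 1) = g x j := by
  obtain ⟨e, he⟩ : ∃ e, f.natDegree = e + 1 := Nat.exists_eq_succ_of_ne_zero h0.ne'
  have h1 : f.coeff (e + 1) = 1 := by rw [← he]; exact hf.coeff_natDegree
  rw [adjoinRootLiftPoly, finsetSum_coeff, he, Nat.add_sub_cancel, Finset.sum_range_succ',
    Finset.sum_eq_zero]
  · rw [coeff_C_mul, coeff_divX_iterate, zero_add, zero_add, h1, mul_one, pow_zero, one_smul]
  · intro i _
    rw [coeff_C_mul, coeff_divX_iterate, coeff_eq_zero_of_natDegree_lt (by omega), mul_zero]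

/-- The extension of `g` to a map into a free module over `AdjoinRoot f`. -/
noncomputable def adjoinRootLift : N →+ (Fin n → AdjoinRoot f) where
  toFun x j := AdjoinRoot.mk f (adjoinRootLiftPoly g f a x j)
  map_zero' := by
    ext j
    simp [adjoinRootLiftPoly]
  map_add' x y := by
    ext j
    simp [adjoinRootLiftPoly, add_mul, Finset.sum_add_distrib]

theorem adjoinRootLift_injective (hf : f.Monic) (h0 : 0 < f.natDegree)
    (hg : Function.Injective g) : Function.Injective (adjoinRootLift g f a) := by
  rw [injective_iff_map_eq_zero]
  intro x hx
  refine (injective_iff_map_eq_zero g).1 hg x (funext fun j => ?_)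
  have h : AdjoinRoot.mk f (adjoinRootLiftPoly g f a x j) = 0 := congrFun hx j
  rw [AdjoinRoot.mk_eq_zero] at h
  rw [← coeff_adjoinRootLiftPoly g f a hf h0]
  by_contra hne
  refine hf.not_dvd_of_degree_lt ?_ (degree_adjoinRootLiftPoly_lt g f a hf h0 x j) h
  intro hz
  exact hne (by rw [hz]; rfl)

variable {g f a}

theorem adjoinRootLift_map_smul (hg : ∀ s x, g (χ s • x) = s • g x) (s : S) (x : N) :
    adjoinRootLift g f a (χ s • x) = AdjoinRoot.of f s • adjoinRootLift g f a x := by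
  ext j
  change AdjoinRoot.mk f (adjoinRootLiftPoly g f a (χ s • x) j) =
    AdjoinRoot.mk f (C s) * AdjoinRoot.mk f (adjoinRootLiftPoly g f a x j)
  rw [← map_mul]
  congr 1
  rw [adjoinRootLiftPoly, adjoinRootLiftPoly, Finset.mul_sum]
  refine Finset.sum_congr rfl fun i _ => ?_
  rw [smul_comm, hg, Pi.smul_apply, smul_eq_mul, C_mul, mul_assoc]

theorem mk_divX_iterate_succ_mul_root (i : ℕ) :
    AdjoinRoot.mk f (divX^[i + 1] f) * AdjoinRoot.root f =
      AdjoinRoot.mk f (divX^[i] f) - AdjoinRoot.of f (f.coeff i) := by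
  have := congrArg (AdjoinRoot.mk f) (divX_mul_X_add (divX^[i] f))
  rw [map_add, map_mul, AdjoinRoot.mk_X, AdjoinRoot.mk_C, coeff_divX_iterate, zero_add,
    ← Function.iterate_succ_apply' (f := divX)] at this
  rw [← this]
  ring

theorem adjoinRootLift_smul (hf : f.Monic) (hfa : f.eval₂ χ a = 0)
    (hg : ∀ s x, g (χ s • x) = s • g x) (x : N) :
    adjoinRootLift g f a (a • x) = AdjoinRoot.root f • adjoinRootLift g f a x := by
  ext j
  change AdjoinRoot.mk f (adjoinRootLiftPoly g f a (a • x) j) =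
    AdjoinRoot.root f * AdjoinRoot.mk f (adjoinRootLiftPoly g f a x j)
  have hsum : ∑ i ∈ Finset.range (f.natDegree + 1), f.coeff i * g (a ^ i • x) j = 0 := by
    have h1 : ∑ i ∈ Finset.range (f.natDegree + 1), (χ (f.coeff i) * a ^ i) • x = 0 := by
      rw [← Finset.sum_smul, ← eval₂_eq_sum_range, hfa, zero_smul]
    have h2 := congrFun (congrArg g h1) j
    rw [map_sum, map_zero, Finset.sum_apply] at h2
    refine Eq.trans ?_ h2
    refine Finset.sum_congr rfl fun i _ => ?_
    rw [mul_smul, hg]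
    rfl
  have hsum' := congrArg (AdjoinRoot.of f) hsum
  rw [map_zero, Finset.sum_range_succ, hf.coeff_natDegree, one_mul, map_add, map_sum] at hsum'
  have hL : AdjoinRoot.mk f (adjoinRootLiftPoly g f a (a • x) j) =
      ∑ i ∈ Finset.range f.natDegree, AdjoinRoot.of f (g (a ^ (i + 1) • x) j) *
        AdjoinRoot.mk f (divX^[i + 1] f) := by
    rw [adjoinRootLiftPoly, map_sum]
    refine Finset.sum_congr rfl fun i _ => ?_
    rw [map_mul, AdjoinRoot.mk_C, smul_smul, pow_succ]
  have hR : AdjoinRoot.root f * AdjoinRoot.mk f (adjoinRootLiftPoly g f a x j) =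
      ∑ i ∈ Finset.range f.natDegree, (AdjoinRoot.of f (g (a ^ i • x) j) *
        AdjoinRoot.mk f (divX^[i] f) - AdjoinRoot.of f (f.coeff i * g (a ^ i • x) j)) := by
    rw [adjoinRootLiftPoly, map_sum, Finset.mul_sum]
    refine Finset.sum_congr rfl fun i _ => ?_
    rw [map_mul, AdjoinRoot.mk_C, map_mul]
    linear_combination (AdjoinRoot.of f (g (a ^ i • x) j)) * mk_divX_iterate_succ_mul_root (f := f) i
  have hshift := (Finset.sum_range_succ' (fun i => AdjoinRoot.of f (g (a ^ i • x) j) *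
    AdjoinRoot.mk f (divX^[i] f)) f.natDegree).symm.trans (Finset.sum_range_succ _ _)
  rw [divX_iterate_natDegree hf, Function.iterate_zero_apply, AdjoinRoot.mk_self, mul_zero,
    add_zero, map_one, mul_one] at hshift
  rw [hL, hR, Finset.sum_sub_distrib, hshift]
  linear_combination hsum'

theorem adjoinRootLift_lift_smul (hf : f.Monic) (hfa : f.eval₂ χ a = 0)
    (hg : ∀ s x, g (χ s • x) = s • g x) (z : AdjoinRoot f) (x : N) :
    adjoinRootLift g f a (AdjoinRoot.lift χ a hfa z • x) = z • adjoinRootLift g f a x := by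
  obtain ⟨p, rfl⟩ := AdjoinRoot.mk_surjective z
  induction p using Polynomial.induction_on' generalizing x with
  | add p q hp hq => rw [map_add, map_add, add_smul, map_add, hp, hq, add_smul]
  | monomial k c =>
    rw [← C_mul_X_pow_eq_monomial, map_mul, map_mul, map_pow, map_pow, AdjoinRoot.mk_C,
      AdjoinRoot.mk_X, AdjoinRoot.lift_of, AdjoinRoot.lift_root, mul_smul,
      adjoinRootLift_map_smul hg, mul_smul]
    congr 1
    induction k with
    | zero => simp
    | succ k ih =>
      rw [pow_succ', mul_smul, adjoinRootLift_smul hf hfa hg, ih, smul_smul, ← pow_succ']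

end Lift

theorem IsGorensteinEmbedding.exists_of_list {A N : Type} [CommRing A] [IsLocalRing A]
    [AddCommGroup N] [Module A N] (as : List A) (has : ∀ a ∈ as, a ∈ maximalIdeal A) :
    ∀ (S : Type) [CommRing S] [IsLocalRing S] [IsNoetherianRing S] (χ : S →+* A) (rs : List S)
      (n : ℕ) (g : N →+ (Fin n → S)), IsGorensteinEmbedding χ rs g →
    ∃ (S' : Type) (_ : CommRing S') (_ : IsLocalRing S') (_ : IsNoetherianRing S') (χ' : S' →+* A)
      (rs' : List S') (n' : ℕ) (g' : N →+ (Fin n' → S')), rs'.length = rs.length ∧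
      IsGorensteinEmbedding χ' rs' g' ∧ χ.range ≤ χ'.range ∧ ∀ a ∈ as, a ∈ χ'.range := by
  induction as with
  | nil =>
    intro S _ _ _ χ rs n g h
    exact ⟨S, _, _, ‹_›, χ, rs, n, g, rfl, h, le_rfl, by simp⟩
  | cons a as ih =>
    intro S _ _ _ χ rs n g h
    have ham : a ∈ maximalIdeal A := has a (by simp)
    obtain ⟨f, hf, h0, hfa⟩ := exists_isDistinguishedAt_eval₂_eq_zero h.finite ham
    have hloc := isLocalRing_adjoinRoot hf h0
    let χ₁ := AdjoinRoot.lift χ a hfa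
    have hcomp : χ₁.comp (AdjoinRoot.of f) = χ := AdjoinRoot.lift_comp_of hfa
    have hof : ∀ s, χ₁ (AdjoinRoot.of f s) = χ s := fun s => AdjoinRoot.lift_of hfa
    have hroot : χ₁ (AdjoinRoot.root f) = a := AdjoinRoot.lift_root hfa
    have h₁ : IsGorensteinEmbedding χ₁ (rs.map (AdjoinRoot.of f)) (adjoinRootLift g f a) := by
      refine ⟨?_, fun x => ?_, ?_, h.seq.map_of hf h0,
        adjoinRootLift_injective g f a hf.monic h0 h.injective,
        adjoinRootLift_lift_smul hf.monic hfa h.map_smul⟩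
      · intro b hb
        rw [maximalIdeal_adjoinRoot hf h0] at hb
        refine (show Ideal.span {AdjoinRoot.root f} ⊔ (maximalIdeal S).map (AdjoinRoot.of f) ≤
          (maximalIdeal A).comap χ₁ from sup_le ?_ (Ideal.map_le_iff_le_comap.2 fun s hs => ?_)) hb
        · rw [Ideal.span_singleton_le_iff_mem, Ideal.mem_comap, hroot]
          exact ham
        · rw [Ideal.mem_comap, Ideal.mem_comap, hof]
          exact h.map_mem s hs
      · obtain ⟨b, hb⟩ := h.residue x
        exact ⟨AdjoinRoot.of f b, by rwa [hof]⟩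
      · refine RingHom.Finite.of_comp_finite (f := AdjoinRoot.of f) ?_
        rw [hcomp]
        exact h.finite
    obtain ⟨S', i1, i2, i3, χ', rs', n', g', hlen, h', hle, hmem⟩ :=
      ih (fun b hb => has b (by simp [hb])) _ _ _ _ _ h₁
    refine ⟨S', i1, i2, i3, χ', rs', n', g', by rw [hlen, List.length_map], h', ?_, ?_⟩
    · refine le_trans ?_ hle
      rintro _ ⟨s, rfl⟩
      exact ⟨AdjoinRoot.of f s, hof s⟩
    · rintro b hb
      rcases List.mem_cons.1 hb with rfl | hb
      · exact hle ⟨AdjoinRoot.root f, hroot⟩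
      · exact hmem b hb

theorem IsGorensteinEmbedding.exists_surjective {A N S : Type} [CommRing A] [IsLocalRing A]
    [AddCommGroup N] [Module A N] [CommRing S] [IsLocalRing S] [IsNoetherianRing S] {χ : S →+* A}
    {rs : List S} {n : ℕ} {g : N →+ (Fin n → S)} (h : IsGorensteinEmbedding χ rs g) :
    ∃ (S' : Type) (_ : CommRing S') (_ : IsLocalRing S') (_ : IsNoetherianRing S') (χ' : S' →+* A)
      (rs' : List S') (n' : ℕ) (g' : N →+ (Fin n' → S')), rs'.length = rs.length ∧
      IsGorensteinEmbedding χ' rs' g' ∧ Function.Surjective χ' := by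
  let := χ.toAlgebra
  have : Module.Finite S A := h.finite
  obtain ⟨T, hT⟩ := Module.Finite.fg_top (R := S) (M := A)
  choose b hb using h.residue
  obtain ⟨S', i1, i2, i3, χ', rs', n', g', hlen, h', hle, hmem⟩ :=
    exists_of_list (T.toList.map fun t => t - χ (b t)) (by
      intro a ha
      obtain ⟨t, -, rfl⟩ := List.mem_map.1 ha
      exact hb t) _ _ _ _ _ h
  refine ⟨S', i1, i2, i3, χ', rs', n', g', hlen, h', fun a => ?_⟩
  have ha : a ∈ Submodule.span S (T : Set A) := hT ▸ Submodule.mem_top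
  change a ∈ χ'.range
  induction ha using Submodule.span_induction with
  | mem t ht =>
    have := hmem (t - χ (b t)) (List.mem_map.2 ⟨t, by simpa using ht, rfl⟩)
    have h2 : χ (b t) ∈ χ'.range := hle ⟨b t, rfl⟩
    simpa using add_mem this h2
  | zero => exact zero_mem _
  | add x y _ _ hx hy => exact add_mem hx hy
  | smul s x _ hx => exact mul_mem (hle ⟨s, rfl⟩) hx

/-- A finitely generated module over a complete local ring, all of whose associated primes have
dimension `d ≥ dim A`, embeds into a free module over a Gorenstein ring mapping onto `A`. -/
theorem exists_gorenstein_embedding {A N : Type} [CommRing A] [IsLocalRing A] [IsNoetherianRing A]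
    [IsAdicComplete (maximalIdeal A) A] [AddCommGroup N] [Module A N] [Module.Finite A N] {d : ℕ}
    (hd : ringKrullDim A ≤ d)
    (hass : ∀ q : Ideal A, IsAssociatedPrime q N → ringKrullDim (A ⧸ q) = d) :
    ∃ (S : Type) (_ : CommRing S) (_ : IsLocalRing S), IsGorensteinLocalRing S ∧
      ringKrullDim S = d ∧ ∃ χ : S →+* A, Function.Surjective χ ∧ ∃ n : ℕ, 0 < n ∧
      ∃ g : N → (Fin n → S), Function.Injective g ∧ (∀ x y, g (x + y) = g x + g y) ∧
        ∀ (s : S) (x : N), g (χ s • x) = s • g x := by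
  obtain ⟨P, _, _, _, _, ψ, L, rs, hc, hfin, rfl⟩ := exists_isHypersurfaceCover hd
  obtain ⟨S₀, _, _, _, χ₀, rs₀, n₀, g₀, hlen₀, h₀⟩ := hc.exists_isGorensteinEmbedding hfin hass
  obtain ⟨S, i1, i2, i3, χ, rs', n, g, hlen, h, hsurj⟩ := h₀.exists_surjective
  refine ⟨S, i1, i2, h.seq.isGorensteinLocalRing, by rw [h.seq.ringKrullDim_eq, hlen, hlen₀],
    χ, hsurj, n + 1, n.succ_pos, fun x => Fin.cons 0 (g x), ?_, ?_, ?_⟩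
  · intro x y hxy
    exact h.injective (Fin.cons_injective2 hxy).2
  · intro x y
    ext j
    refine Fin.cases ?_ (fun j => ?_) j <;> simp
  · intro s x
    ext j
    refine Fin.cases ?_ (fun j => ?_) j <;> simp [h.map_smul]

end AdjoinRootEmbedding

end UnmixedEmbedding

theorem statement3 (R : Type) [CommRing R] [IsLocalRing R] [IsNoetherianRing R]
    (M : Type) [AddCommGroup M] [Module R M] [Module.Finite R M]
    (hdim : mDim R M = ringKrullDim R) :
    IsUnmixed R M ↔
      ∃ (S : Type) (_ : CommRing S) (_ : IsLocalRing S),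
        IsGorensteinLocalRing S ∧ ringKrullDim S = ringKrullDim R ∧
        ∃ f : S →+* AdicCompletion (maximalIdeal R) R, Function.Surjective f ∧
        ∃ n : ℕ, 0 < n ∧
        ∃ g : AdicCompletion (maximalIdeal R) M → (Fin n → S),
          Function.Injective g ∧ (∀ x y, g (x + y) = g x + g y) ∧
          ∀ (s : S) (x : AdicCompletion (maximalIdeal R) M),
            g (f s • x) = s • g x := by
  constructor
  · intro h
    obtain ⟨d, hd⟩ : ∃ d : ℕ, ringKrullDim R = d := ⟨(maximalIdeal R).height.toNat, by
      rw [← maximalIdeal_height_eq_ringKrullDim]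
      exact congrArg _ (ENat.natCast_toNat (Ideal.height_ne_top (Ideal.IsPrime.ne_top'))).symm⟩
    have := UnmixedEmbedding.finite_adicCompletion R M
    rw [hd]
    exact UnmixedEmbedding.exists_gorenstein_embedding
      (UnmixedEmbedding.ringKrullDim_adicCompletion_le R hd.le)
      fun q hq => (h q hq).trans (hdim.trans hd)
  · rintro ⟨S, _, _, hS, hSR, f, hf, n, -, g, hg, hadd, hsmul⟩ p hp
    have := hS.1
    rw [UnmixedEmbedding.ringKrullDim_quotient_eq_of_embedding hS.2.1 f hf g hg hadd hsmul hp,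
      hSR, hdim]
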